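/- (Hermitian product convolution gives a Hall–Littlewood process, case k = 1.) Fix n ≥ 1, t ∈ (0,1), positive reals a_1,…,a_n, and nonnegative reals b_1,…,b_r and c_1,…,c_s with a_i b_j² < 1 and a_i c_j < 1 for all i, j. Write a = (a_1,…,a_n), a'' = (a_1²,…,a_n²), ψ = (b_1²,…,b_r²), ψ_1 = (c_1²,…,c_s²), ψ_1* = (c_1, −c_1, …, c_s, −c_s), and for lists u, w and parameter τ set Π_τ(u;w) = ∏_{i,j} (1 − τ u_i w_j)/(1 − u_i w_j). For each μ ∈ Sig_n^+ and κ, κ' ∈ Sig_n, let c_{μ,κ}^{her,κ'}(t) ∈ ℝ be the evaluation at t of the unique finitely supported family of polynomials in ℤ[T] with P_μ(x_1²,…,x_n²;T²)·P_κ(x;−T) = ∑_{κ'} c_{μ,κ}^{her,κ'}(T)·P_{κ'}(x;−T). Then for all λ, λ' ∈ Sig_n^+: [P_λ(a;−t)·Q_{λ/0[n]}(ψ;−t)/Π_{−t}(a;ψ)] · ∑_{μ ∈ Sig_n^+} [P_μ(a'';t²)·Q_{μ/0[n]}(ψ_1;t²)/Π_{t²}(a'';ψ_1)] · [c_{μ,λ}^{her,λ'}(t)·P_{λ'}(a;−t)/(P_μ(a'';t²)·P_λ(a;−t))]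 = Q_{λ/0[n]}(ψ;−t)·Q_{λ'/λ}(ψ_1*;−t)·P_{λ'}(a;−t)/(Π_{−t}(a;ψ)·Π_{−t}(a;ψ_1*)), where the sum over μ has only finitely many nonzero terms (c_{μ,λ}^{her,λ'} = 0 unless 2|μ| = |λ'| − |λ|), all Hall–Littlewood polynomials are evaluated at the indicated real arguments with parameter −t or t² as indicated, and all denominators appearing are nonzero. -/

import Mathlib

open scoped Classical

noncomputable section

/-- Sum of the parts of an integer tuple. -/
def sumz {p : ℕ} (l : Fin p → ℤ) : ℤ := ∑ i, l i

/-- `mcount l c = m_c(l)`, the number of parts of `l` equal to `c`. -/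
def mcount {p : ℕ} (l : Fin p → ℤ) (c : ℤ) : ℕ := (Finset.univ.filter fun j => l j = c).card

/-- `l` is a signature: its parts are weakly decreasing. -/
def IsSig {p : ℕ} (l : Fin p → ℤ) : Prop := ∀ i j : Fin p, i ≤ j → l j ≤ l i

/-- `μ ≺_P l`: `l i ≥ μ i ≥ l (i+1)` for all `i`. -/
def interP {m : ℕ} (μ : Fin m → ℤ) (l : Fin (m + 1) → ℤ) : Prop :=
  ∀ i : Fin m, μ i ≤ l i.castSucc ∧ l i.succ ≤ μ i

/-- `ν ≺_Q l`: `l i ≥ ν i` for all `i`, and `ν i ≥ l (i+1)`. -/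
def interQ {n : ℕ} (ν l : Fin n → ℤ) : Prop :=
  (∀ i, ν i ≤ l i) ∧ ∀ i j : Fin n, (j : ℕ) = (i : ℕ) + 1 → l j ≤ ν i

/-- `ψ_{l/μ}(t) = ∏_{i : m_i(μ) = m_i(l) + 1} (1 − t^{m_i(μ)})`. -/
def psiHL {K : Type} [Field K] {p : ℕ} (t : K) (l : Fin (p + 1) → ℤ) (μ : Fin p → ℤ) : K :=
  ∏ᶠ c : ℤ, if mcount μ c = mcount l c + 1 then 1 - t ^ mcount μ c else 1

/-- `φ_{l/ν}(t) = ∏_{i : m_i(l) = m_i(ν) + 1} (1 − t^{m_i(l)})`. -/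
def phiHL {K : Type} [Field K] {p : ℕ} (t : K) (l ν : Fin p → ℤ) : K :=
  ∏ᶠ c : ℤ, if mcount l c = mcount ν c + 1 then 1 - t ^ mcount l c else 1

/-- Skew Hall–Littlewood polynomial `P_{l/μ}(x₁,…,x_k;t)`, via the branching rule, as a
function of `x : Fin k → K`. -/
def HLP {K : Type} [Field K] {m : ℕ} (t : K) :
    (k : ℕ) → (Fin m → ℤ) → (Fin (m + k) → ℤ) → (Fin k → K) → K
  | 0, μ, l, _ => if μ = l then 1 else 0
  | k + 1, μ, l, x =>
    ∑ᶠ ν : Fin (m + k) → ℤ,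
      if interP ν l then
        psiHL t l ν * x (Fin.last k) ^ (sumz l - sumz ν) * HLP t k μ ν fun i => x i.castSucc
      else 0

/-- Skew Hall–Littlewood polynomial `Q_{l/ν}(x₁,…,x_k;t)` (`ν` and `l` both of length `n`),
via the branching rule, as a function of `x : Fin k → K`. -/
def HLQ {K : Type} [Field K] {n : ℕ} (t : K) :
    (k : ℕ) → (Fin n → ℤ) → (Fin n → ℤ) → (Fin k → K) → K
  | 0, ν, l, _ => if ν = l then 1 else 0
  | k + 1, ν, l, x =>
    ∑ᶠ κ : Fin n → ℤ,
      if interQ κ l then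
        phiHL t l κ * x (Fin.last k) ^ (sumz l - sumz κ) * HLQ t k ν κ fun i => x i.castSucc
      else 0

/-- The (non-skew) Hall–Littlewood polynomial `P_l(x₁,…,x_n;t) = P_{l/∅}(x₁,…,x_n;t)`. -/
def HLPfull {K : Type} [Field K] {n : ℕ} (t : K) (l : Fin n → ℤ) (x : Fin n → K) : K :=
  HLP t n (fun i : Fin 0 => 0) (fun i => l (Fin.cast (Nat.zero_add n) i)) x

/-- `poch t m = (t;t)_m = ∏_{j=1}^m (1 − t^j)`. -/
def poch {K : Type} [Field K] (t : K) (m : ℕ) : K := ∏ j ∈ Finset.range m, (1 - t ^ (j + 1))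


/-- The Cauchy kernel `Π_τ(u; w) = ∏_{i,j} (1 − τ uᵢ wⱼ)/(1 − uᵢ wⱼ)`. -/
def PiK {K : Type} [Field K] {p q : ℕ} (τ : K) (u : Fin p → K) (w : Fin q → K) : K :=
  ∏ i, ∏ j, (1 - τ * u i * w j) / (1 - u i * w j)

/-- The list `(x₁, −x₁, x₂, −x₂, …, x_m, −x_m)` of `2m` values. -/
def signList {K : Type} [Field K] {m : ℕ} (x : Fin m → K) : Fin (2 * m) → K :=
  fun i => (-1 : K) ^ (i.val % 2) * x ⟨i.val / 2, by have := i.isLt; omega⟩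

/-- `c` is a finitely supported family of polynomials in `ℤ[T]`, supported on signatures, with
`P_μ(x₁², …, x_n²; T²) · P_ν(x₁,…,x_n; −T) = ∑_λ c_λ(T) · P_λ(x₁,…,x_n; −T)` as Laurent
polynomials (formalized as holding over every field at nonzero arguments). -/
def herExpand (n : ℕ) (μ : Fin n → ℤ) (ν : Fin n → ℤ)
    (c : (Fin n → ℤ) → Polynomial ℤ) : Prop :=
  {l : Fin n → ℤ | c l ≠ 0}.Finite ∧ (∀ l, c l ≠ 0 → IsSig l) ∧
  ∀ (K : Type) [Field K] (T : K) (x : Fin n → K), (∀ i, x i ≠ 0) →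
    HLPfull (T ^ 2) μ (fun i => x i ^ 2) * HLPfull (-T) ν x
      = ∑ᶠ l : Fin n → ℤ, Polynomial.aeval T (c l) * HLPfull (-T) l x


/-! ### Counting functions -/

/-- number of parts at least `c` -/
def cnt {p : ℕ} (l : Fin p → ℤ) (c : ℤ) : ℕ := (Finset.univ.filter fun j => c ≤ l j).card

lemma cnt_eq {p : ℕ} (l : Fin p → ℤ) (c : ℤ) : cnt l c = mcount l c + cnt l (c + 1) := by
  unfold cnt mcount
  rw [← Finset.card_union_of_disjoint]
  · congr 1
    ext j
    simp only [Finset.mem_filter, Finset.mem_univ, true_and, Finset.mem_union]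
    omega
  · rw [Finset.disjoint_left]
    intro j
    simp only [Finset.mem_filter, Finset.mem_univ, true_and]
    omega

lemma cnt_le {p : ℕ} (l : Fin p → ℤ) (c : ℤ) : cnt l c ≤ p := by
  unfold cnt
  exact (Finset.card_le_univ _).trans (by simp)

lemma cnt_low {p : ℕ} (l : Fin p → ℤ) (c : ℤ) (h : ∀ i, c ≤ l i) : cnt l c = p := by
  unfold cnt
  rw [Finset.filter_true_of_mem (fun i _ => h i)]
  simp

lemma cnt_high {p : ℕ} (l : Fin p → ℤ) (c : ℤ) (h : ∀ i, l i < c) : cnt l c = 0 := by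
  unfold cnt
  rw [Finset.card_eq_zero, Finset.filter_eq_empty_iff]
  intro i _
  have := h i
  omega

lemma mcount_zero {p : ℕ} (l : Fin p → ℤ) (c : ℤ) (h : ∀ i, l i ≠ c) : mcount l c = 0 := by
  unfold mcount
  rw [Finset.card_eq_zero, Finset.filter_eq_empty_iff]
  intro i _
  exact h i

lemma card_fin_lt (p N : ℕ) (h : N ≤ p) :
    (Finset.univ.filter fun j : Fin p => (j : ℕ) < N).card = N := by
  have : (Finset.univ.filter fun j : Fin p => (j : ℕ) < N) =
      Finset.univ.map (Fin.castLEEmb h) := by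
    ext j
    simp only [Finset.mem_filter, Finset.mem_univ, true_and, Finset.mem_map, Fin.castLEEmb_apply]
    constructor
    · intro hj
      exact ⟨⟨j, hj⟩, Fin.ext rfl⟩
    · rintro ⟨i, rfl⟩
      exact i.2
  rw [this, Finset.card_map]
  simp

lemma le_iff_lt_cnt {p : ℕ} {l : Fin p → ℤ} (hl : IsSig l) (i : Fin p) (c : ℤ) :
    c ≤ l i ↔ (i : ℕ) < cnt l c := by
  constructor
  · intro h
    have : (Finset.univ.filter fun j : Fin p => (j : ℕ) < i + 1) ⊆
        Finset.univ.filter fun j => c ≤ l j := by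
      intro j
      simp only [Finset.mem_filter, Finset.mem_univ, true_and]
      intro hj
      exact h.trans (hl j i (by rw [Fin.le_def]; omega))
    have h2 := Finset.card_le_card this
    rw [card_fin_lt p (i + 1) (by omega)] at h2
    unfold cnt
    omega
  · intro h
    by_contra hc
    have : (Finset.univ.filter fun j => c ≤ l j) ⊆
        (Finset.univ.filter fun j : Fin p => (j : ℕ) < i) := by
      intro j
      simp only [Finset.mem_filter, Finset.mem_univ, true_and]
      intro hj
      by_contra hji
      exact hc (hj.trans (hl i j (by rw [Fin.le_def]; omega)))
    have h2 := Finset.card_le_card this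
    rw [card_fin_lt p i (by omega)] at h2
    unfold cnt at h
    omega

lemma cnt_anti {p : ℕ} (l : Fin p → ℤ) (c : ℤ) : cnt l (c + 1) ≤ cnt l c := by
  have := cnt_eq l c; omega

lemma sig_ext {p : ℕ} {l l' : Fin p → ℤ} (hl : IsSig l) (hl' : IsSig l')
    (h : ∀ c, cnt l c = cnt l' c) : l = l' := by
  funext i
  apply le_antisymm
  · rw [le_iff_lt_cnt hl', ← h, ← le_iff_lt_cnt hl]
  · rw [le_iff_lt_cnt hl, h, ← le_iff_lt_cnt hl']

lemma exists_sig (p : ℕ) (N : ℤ → ℕ) (lo hi : ℤ) (hlo : ∀ c ≤ lo, N c = p)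
    (hhi : ∀ c, hi ≤ c → N c = 0) (hN : ∀ c, N (c + 1) ≤ N c) :
    ∃ l : Fin p → ℤ, IsSig l ∧ (∀ i, lo ≤ l i ∧ l i < hi) ∧ ∀ c, cnt l c = N c := by
  have hanti : Antitone N := antitone_int_of_succ_le hN
  have hle : ∀ c, N c ≤ p := by
    intro c
    rcases le_total c lo with h | h
    · exact (hlo c h).le
    · exact (hanti h).trans (hlo lo le_rfl).le
  have key : ∀ i : Fin p, ∃ m : ℤ, (i : ℕ) < N m ∧ ∀ z : ℤ, (i : ℕ) < N z → z ≤ m := by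
    intro i
    apply Int.exists_greatest_of_bdd (P := fun c => (i : ℕ) < N c)
    · refine ⟨hi, fun z hz => ?_⟩
      by_contra hc
      have := hhi z (by omega)
      omega
    · exact ⟨lo, by rw [hlo lo le_rfl]; exact i.2⟩
  choose l hl1 hl2 using key
  have hiff : ∀ i c, c ≤ l i ↔ (i : ℕ) < N c := by
    intro i c
    exact ⟨fun h => (hl1 i).trans_le (hanti h), hl2 i c⟩
  refine ⟨l, ?_, ?_, ?_⟩
  · intro i j hij
    rw [hiff]
    rw [Fin.le_def] at hij
    have := hl1 j
    omega
  · intro i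
    constructor
    · rw [hiff, hlo lo le_rfl]; exact i.2
    · by_contra hc
      have h1 := hl1 i
      rw [hhi _ (by omega)] at h1
      omega
  · intro c
    unfold cnt
    simp only [hiff]
    exact card_fin_lt p _ (hle c)

lemma interP_iff {m : ℕ} {μ : Fin m → ℤ} {l : Fin (m + 1) → ℤ} (hμ : IsSig μ) (hl : IsSig l) :
    interP μ l ↔ ∀ c, cnt l c = cnt μ c ∨ cnt l c = cnt μ c + 1 := by
  constructor
  · intro h c
    have h1 : cnt μ c ≤ cnt l c := by
      by_contra hc
      have h3 := cnt_le μ c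
      have h4 := (le_iff_lt_cnt hμ ⟨cnt l c, by omega⟩ c).2 (by simpa using hc)
      have h5 := h4.trans (h _).1
      rw [le_iff_lt_cnt hl] at h5
      simp at h5
    have h2 : cnt l c ≤ cnt μ c + 1 := by
      by_contra hc
      have h3 := cnt_le l c
      have h4 := (le_iff_lt_cnt hl (Fin.succ ⟨cnt μ c, by omega⟩) c).2 (by simp; omega)
      have h5 := h4.trans (h _).2
      rw [le_iff_lt_cnt hμ] at h5
      simp at h5
    omega
  · intro h i
    constructor
    · rw [le_iff_lt_cnt hl]
      have h1 := (le_iff_lt_cnt hμ i (μ i)).1 le_rfl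
      have := h (μ i)
      simp only [Fin.val_castSucc]
      omega
    · rw [le_iff_lt_cnt hμ]
      have h1 := (le_iff_lt_cnt hl i.succ (l i.succ)).1 le_rfl
      have := h (l i.succ)
      simp only [Fin.val_succ] at h1
      omega

lemma interQ_iff {n : ℕ} {ν l : Fin n → ℤ} (hν : IsSig ν) (hl : IsSig l) :
    interQ ν l ↔ ∀ c, cnt l c = cnt ν c ∨ cnt l c = cnt ν c + 1 := by
  constructor
  · rintro ⟨ha, hb⟩ c
    have h1 : cnt ν c ≤ cnt l c := by
      by_contra hc
      have h3 := cnt_le ν c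
      have h4 := (le_iff_lt_cnt hν ⟨cnt l c, by omega⟩ c).2 (by simpa using hc)
      have h5 := h4.trans (ha _)
      rw [le_iff_lt_cnt hl] at h5
      simp at h5
    have h2 : cnt l c ≤ cnt ν c + 1 := by
      by_contra hc
      have h3 := cnt_le l c
      have h4 := (le_iff_lt_cnt hl ⟨cnt ν c + 1, by omega⟩ c).2 (by simp; omega)
      have h5 := h4.trans (hb ⟨cnt ν c, by omega⟩ _ rfl)
      rw [le_iff_lt_cnt hν] at h5
      simp at h5
    omega
  · intro h
    constructor
    · intro i
      rw [le_iff_lt_cnt hl]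
      have h1 := (le_iff_lt_cnt hν i (ν i)).1 le_rfl
      have := h (ν i)
      omega
    · intro i j hij
      rw [le_iff_lt_cnt hν]
      have h1 := (le_iff_lt_cnt hl j (l j)).1 le_rfl
      have := h (l j)
      omega

lemma sig_of_adj {n : ℕ} {l : Fin n → ℤ}
    (h : ∀ i j : Fin n, (j : ℕ) = (i : ℕ) + 1 → l j ≤ l i) : IsSig l := by
  have key : ∀ d : ℕ, ∀ i j : Fin n, (j : ℕ) = (i : ℕ) + d → l j ≤ l i := by
    intro d
    induction d with
    | zero => intro i j hij; rw [Fin.ext (a := j) (b := i) (by omega)]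
    | succ d ih =>
      intro i j hij
      have hj := j.2
      exact (h ⟨i + d, by omega⟩ j (by simp; omega)).trans (ih i _ rfl)
  intro i j hij
  exact key (j - i) i j (by rw [Fin.le_def] at hij; omega)

lemma interQ_sig_left {n : ℕ} {ν l : Fin n → ℤ} (h : interQ ν l) : IsSig ν :=
  sig_of_adj fun i j hij => (h.1 j).trans (h.2 i j hij)

lemma interQ_sig_right {n : ℕ} {ν l : Fin n → ℤ} (h : interQ ν l) : IsSig l :=
  sig_of_adj fun i j hij => (h.2 i j hij).trans (h.1 i)

lemma interP_sig_left {m : ℕ} {μ : Fin m → ℤ} {l : Fin (m + 1) → ℤ} (h : interP μ l) :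
    IsSig μ := by
  apply sig_of_adj
  intro i j hij
  have h1 := (h j).1
  have h2 := (h i).2
  have : i.succ = j.castSucc := Fin.ext (by simp; omega)
  rw [this] at h2
  exact h1.trans h2

lemma interP_sig_right {m : ℕ} {μ : Fin m → ℤ} {l : Fin (m + 1) → ℤ} (h : interP μ l) :
    IsSig l := by
  apply sig_of_adj
  intro i j hij
  have hj := j.2
  have h1 := h ⟨i, by omega⟩
  have e1 : (Fin.castSucc ⟨i, by omega⟩ : Fin (m + 1)) = i := Fin.ext (by simp)
  have e2 : (Fin.succ ⟨(i : ℕ), by omega⟩ : Fin (m + 1)) = j := Fin.ext (by simp; omega)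
  rw [e1, e2] at h1
  exact h1.2.trans h1.1

lemma sumz_eq_cnt {p : ℕ} (l : Fin p → ℤ) (lo hi : ℤ) (h : ∀ i, lo ≤ l i ∧ l i < hi) :
    sumz l = p * lo + ∑ c ∈ Finset.Ioo lo hi, (cnt l c : ℤ) := by
  have h1 : ∀ i, l i = lo + ∑ c ∈ Finset.Ioo lo hi, if c ≤ l i then (1 : ℤ) else 0 := by
    intro i
    rw [← Finset.sum_filter, Finset.sum_const]
    have : (Finset.filter (fun c => c ≤ l i) (Finset.Ioo lo hi)) = Finset.Ioc lo (l i) := by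
      ext c
      have := h i
      simp only [Finset.mem_filter, Finset.mem_Ioo, Finset.mem_Ioc]
      omega
    rw [this, Int.card_Ioc]
    have := h i
    simp
    omega
  unfold sumz
  rw [Finset.sum_congr rfl (fun i _ => h1 i), Finset.sum_add_distrib, Finset.sum_comm]
  simp only [Finset.sum_const, Finset.card_univ, Fintype.card_fin, nsmul_eq_mul, cnt,
    Finset.sum_boole]

/-! ### The transfer-matrix identity -/

/-- local weight of a part multiplicity -/
def Fw {R : Type} [CommRing R] (t : R) (p r : ℕ) (m : ℤ) : R :=
  (if m = p + 1 then 1 - t ^ (p + 1) else 1) * (if (r : ℤ) = m + 1 then 1 - t ^ r else 1)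

/-- one-site transfer weight, upper side -/
def wL {R : Type} [CommRing R] (t u : R) (p r : ℕ) (e h h' : ℤ) : R :=
  if 0 ≤ p + h - h' ∧ (e + h = 0 ∨ e + h = 1) then Fw t p r (p + h - h') * u ^ h.toNat else 0

/-- one-site transfer weight, lower side -/
def wR {R : Type} [CommRing R] (t u : R) (p r : ℕ) (e h h' : ℤ) : R :=
  if 0 ≤ r - h + h' ∧ (e + h = 0 ∨ e + h = 1) then Fw t p r (r - h + h') * u ^ h.toNat else 0

/-- the intertwining relation (up to error terms `E`) -/
def TInv {R : Type} [CommRing R] (t u : R) (e : ℤ) (L S E : ℤ → R) : Prop :=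
  (e = 0 → (1 - u) * L 0 = (1 - u) * S 0 + (1 - t) * S 1 - E 0 ∧
    (1 - u) * L 1 = (1 - t) * u * S 0 + t * (1 - u) * S 1 - E 1) ∧
  (e = 1 → (1 - u) * L 0 = (1 - t * u) * S 0 - E 0 ∧ L 1 = 0 ∧ S 1 = 0 ∧ E 1 = 0) ∧
  (e = -1 → (1 - u) * L 1 = (1 - t * u) * S 1 - E 1 ∧ L 0 = 0 ∧ S 0 = 0 ∧ E 0 = 0) ∧
  ((e < -1 ∨ 1 < e) → L 0 = 0 ∧ S 0 = 0 ∧ E 0 = 0 ∧ L 1 = 0 ∧ S 1 = 0 ∧ E 1 = 0)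

/-- one transfer step -/
def tstep {R : Type} [CommRing R] (w : ℤ → ℤ → R) (V : ℤ → R) : ℤ → R :=
  fun h => w h 0 * V 0 + w h 1 * V 1

lemma wL_bad0 {R : Type} [CommRing R] (t u : R) (p r : ℕ) (e h h' : ℤ)
    (hh : ¬ (e + h = 0 ∨ e + h = 1)) : wL t u p r e h h' = 0 := by
  unfold wL
  rw [if_neg (fun h => hh h.2)]

lemma wR_bad0 {R : Type} [CommRing R] (t u : R) (p r : ℕ) (e h h' : ℤ)
    (hh : ¬ (e + h = 0 ∨ e + h = 1)) : wR t u p r e h h' = 0 := by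
  unfold wR
  rw [if_neg (fun h => hh h.2)]

lemma TInv_step {R : Type} [CommRing R] (t u : R) (p r : ℕ) (e e' : ℤ) (L S E : ℤ → R)
    (he : e = e' + p - r) (H : TInv t u e' L S E) :
    TInv t u e (tstep (wL t u p r e) L) (tstep (wR t u p r e) S) (tstep (wL t u p r e) E) := by
  obtain ⟨H0, H1, H2, H3⟩ := H
  by_cases hbad : e' < -1 ∨ 1 < e'
  · obtain ⟨a1, a2, a3, a4, a5, a6⟩ := H3 hbad
    simp [TInv, tstep, a1, a2, a3, a4, a5, a6]
  have he' : e' = 0 ∨ e' = 1 ∨ e' = -1 := by omega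
  refine ⟨?_, ?_, ?_, ?_⟩
  · intro h0
    subst h0
    rcases he' with rfl | rfl | rfl
    · obtain ⟨a1, a2⟩ := H0 rfl
      obtain rfl : p = r := by omega
      rcases Nat.eq_zero_or_pos p with rfl | hp
      · simp [tstep, wL, wR, Fw]
        constructor
        · linear_combination a1
        · linear_combination u * a2 + u * (1 - t) * a1
      · obtain ⟨p, rfl⟩ : ∃ k, p = k + 1 := ⟨p - 1, by omega⟩
        simp (disch := omega) only [tstep, wL, wR, Fw, if_pos, if_neg]
        simp
        constructor
        · linear_combination a1 + (1 - t ^ (p + 1)) * a2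
        · linear_combination u * a2 + u * (1 - t ^ (p + 2)) * a1
    · obtain ⟨a1, a2, a3, a4⟩ := H1 rfl
      obtain rfl : r = p + 1 := by omega
      simp (disch := omega) only [tstep, wL, wR, Fw, if_pos, if_neg, a2, a3, a4]
      simp
      constructor
      · linear_combination (1 - t ^ (p + 1)) * a1
      · linear_combination u * (1 - t ^ (p + 1)) * a1
    · obtain ⟨a1, a2, a3, a4⟩ := H2 rfl
      obtain rfl : p = r + 1 := by omega
      simp (disch := omega) only [tstep, wL, wR, Fw, if_pos, if_neg, a2, a3, a4]
      simp
      constructor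
      · linear_combination a1
      · linear_combination u * a1
  · intro h0
    subst h0
    refine ⟨?_, ?_, ?_, ?_⟩
    · rcases he' with rfl | rfl | rfl
      · obtain ⟨a1, a2⟩ := H0 rfl
        obtain rfl : p = r + 1 := by omega
        simp (disch := omega) only [tstep, wL, wR, Fw, if_pos, if_neg]
        simp
        linear_combination a1 + a2
      · obtain ⟨a1, a2, a3, a4⟩ := H1 rfl
        obtain rfl : p = r := by omega
        simp (disch := omega) only [tstep, wL, wR, Fw, if_pos, if_neg, a2, a3, a4]
        simp
        linear_combination a1
      · obtain ⟨a1, a2, a3, a4⟩ := H2 rfl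
        obtain rfl : p = r + 2 := by omega
        simp (disch := omega) only [tstep, wL, wR, Fw, if_pos, if_neg, a2, a3, a4]
        simp
        linear_combination a1
    all_goals simp (disch := omega) only [tstep, wL_bad0, wR_bad0, zero_mul, add_zero]
  · intro h0
    subst h0
    refine ⟨?_, ?_, ?_, ?_⟩
    · rcases he' with rfl | rfl | rfl
      · obtain ⟨a1, a2⟩ := H0 rfl
        obtain rfl : r = p + 1 := by omega
        simp (disch := omega) only [tstep, wL, wR, Fw, if_pos, if_neg]
        simp
        linear_combination u * (1 - t ^ (p + 1)) * (a1 + a2)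
      · obtain ⟨a1, a2, a3, a4⟩ := H1 rfl
        obtain rfl : r = p + 2 := by omega
        simp (disch := omega) only [tstep, wL, wR, Fw, if_pos, if_neg, a2, a3, a4]
        simp
        linear_combination u * (1 - t ^ (p + 1)) * (1 - t ^ (p + 2)) * a1
      · obtain ⟨a1, a2, a3, a4⟩ := H2 rfl
        obtain rfl : p = r := by omega
        simp (disch := omega) only [tstep, wL, wR, Fw, if_pos, if_neg, a2, a3, a4]
        simp
        linear_combination u * a1
    all_goals simp (disch := omega) only [tstep, wL_bad0, wR_bad0, zero_mul, add_zero]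
  · intro h0
    simp (disch := omega) only [tstep, wL_bad0, wR_bad0, zero_mul, add_zero, and_self]

/-- iterated transfer, from the top site `hi - 1` downwards -/
def tvec {R : Type} [CommRing R] (w : ℤ → ℤ → ℤ → R) (hi : ℤ) : ℕ → ℤ → R
  | 0 => fun h => if h = 0 then 1 else 0
  | j + 1 => tstep (w (hi - (j + 1 : ℕ))) (tvec w hi j)

lemma tvec_rel {R : Type} [CommRing R] (t u : R) (p r : ℤ → ℕ) (e : ℤ → ℤ) (hi top : ℤ)
    (he : ∀ c, e c = e (c + 1) + p c - r c) (hehi : e hi = 0) (hp : ∀ c, top < c → p c = 0)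
    (D : ℕ) (hD : top + D < hi) (j : ℕ) :
    ∃ E : ℤ → R,
      TInv t u (e (hi - j)) (tvec (fun c => wL t u (p c) (r c) (e c)) hi j)
        (tvec (fun c => wR t u (p c) (r c) (e c)) hi j) E ∧
      (top < hi - j → E 0 = 0 ∧ u ^ j ∣ E 1) ∧
      (hi - j ≤ top → u ^ D ∣ E 0 ∧ u ^ D ∣ E 1) := by
  induction j with
  | zero =>
    refine ⟨fun h => if h = 0 then 0 else (1 - t) * u, ?_, ?_, ?_⟩
    · simp [TInv, tvec, hehi]
    · simp
    · simp; omega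
  | succ j ih =>
    obtain ⟨E, h1, h2, h3⟩ := ih
    set c := hi - ((j + 1 : ℕ) : ℤ) with hc
    have hcj : hi - (j : ℤ) = c + 1 := by rw [hc]; push_cast; ring
    rw [hcj] at h1 h2 h3
    refine ⟨tstep (wL t u (p c) (r c) (e c)) E, TInv_step t u (p c) (r c) (e c) (e (c + 1)) _ _ _
      (he c) h1, ?_, ?_⟩
    · intro htop
      obtain ⟨a1, a2⟩ := h2 (by omega)
      have hpc := hp c htop
      constructor
      · simp [tstep, a1, wL, hpc]
      · simp only [tstep, a1, mul_zero, zero_add]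
        rw [pow_succ']
        apply mul_dvd_mul _ a2
        unfold wL
        split_ifs
        · simp
        · simp
    · intro htop
      have : u ^ D ∣ E 0 ∧ u ^ D ∣ E 1 := by
        by_cases hh : c + 1 ≤ top
        · exact h3 hh
        · obtain ⟨a1, a2⟩ := h2 (by omega)
          rw [a1]
          refine ⟨dvd_zero _, (pow_dvd_pow u ?_).trans a2⟩
          omega
      unfold tstep
      exact ⟨dvd_add (this.1.mul_left _) (this.2.mul_left _),
        dvd_add (this.1.mul_left _) (this.2.mul_left _)⟩

/-- indicator -/
def ind (S : Finset ℤ) (c : ℤ) : ℤ := if c ∈ S then 1 else 0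

lemma powerset_transfer {R : Type} [CommRing R] (w : ℤ → ℤ → ℤ → R) (hi : ℤ) (j : ℕ) :
    ∀ f : ℤ → R,
    ∑ S ∈ (Finset.Ico (hi - j) hi).powerset,
      f (ind S (hi - j)) * ∏ c ∈ Finset.Ico (hi - j) hi, w c (ind S c) (ind S (c + 1))
    = f 0 * tvec w hi j 0 + f 1 * tvec w hi j 1 := by
  induction j with
  | zero => intro f; simp [ind, tvec]
  | succ j ih =>
    intro f
    set a := hi - ((j + 1 : ℕ) : ℤ) with ha
    have haj : hi - (j : ℤ) = a + 1 := by rw [ha]; push_cast; ring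
    rw [haj] at ih
    have hins : Finset.Ico a hi = insert a (Finset.Ico (a + 1) hi) := by
      ext c
      simp only [Finset.mem_Ico, Finset.mem_insert]
      omega
    have hna : a ∉ Finset.Ico (a + 1) hi := by simp
    rw [hins, Finset.sum_powerset_insert hna, ← Finset.sum_add_distrib]
    have := ih (fun x => f 0 * w a 0 x + f 1 * w a 1 x)
    have e2 : f 0 * tvec w hi (j + 1) 0 + f 1 * tvec w hi (j + 1) 1 =
        (f 0 * w a 0 0 + f 1 * w a 1 0) * tvec w hi j 0 +
        (f 0 * w a 0 1 + f 1 * w a 1 1) * tvec w hi j 1 := by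
      simp only [tvec, tstep, ← ha]
      ring
    rw [e2, ← this]
    apply Finset.sum_congr rfl
    intro S hS
    rw [Finset.mem_powerset] at hS
    have haS : a ∉ S := fun h => hna (hS h)
    rw [Finset.prod_insert hna, Finset.prod_insert hna]
    have i1 : ind S a = 0 := by simp [ind, haS]
    have i2 : ind (insert a S) a = 1 := by simp [ind]
    have i3 : ∀ c, a < c → ind (insert a S) c = ind S c := by
      intro c hc
      have : c ≠ a := by omega
      simp [ind, this]
    have i4 : ∏ c ∈ Finset.Ico (a + 1) hi, w c (ind (insert a S) c) (ind (insert a S) (c + 1)) =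
        ∏ c ∈ Finset.Ico (a + 1) hi, w c (ind S c) (ind S (c + 1)) := by
      apply Finset.prod_congr rfl
      intro c hc
      rw [Finset.mem_Ico] at hc
      rw [i3 c (by omega), i3 (c + 1) (by omega)]
    rw [i4, i1, i2, i3 (a + 1) (by omega)]
    ring

lemma powerset_transfer' {R : Type} [CommRing R] (w : ℤ → ℤ → ℤ → R) (lo hi : ℤ) (h : lo < hi) :
    ∑ S ∈ (Finset.Ioo lo hi).powerset,
      ∏ c ∈ Finset.Ico lo hi, w c (ind S c) (ind S (c + 1))
    = tvec w hi (hi - lo).toNat 0 := by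
  obtain ⟨j, hj⟩ : ∃ j : ℕ, (hi - lo).toNat = j + 1 := ⟨(hi - lo).toNat - 1, by omega⟩
  have hlo : hi - ((j + 1 : ℕ) : ℤ) = lo := by omega
  have hlo1 : hi - (j : ℤ) = lo + 1 := by omega
  have := powerset_transfer w hi j (w lo 0)
  rw [hlo1] at this
  rw [hj]
  simp only [tvec, tstep]
  rw [hlo, ← this]
  have e1 : Finset.Ioo lo hi = Finset.Ico (lo + 1) hi := by
    ext c; simp only [Finset.mem_Ioo, Finset.mem_Ico]; omega
  have hins : Finset.Ico lo hi = insert lo (Finset.Ico (lo + 1) hi) := by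
    ext c
    simp only [Finset.mem_Ico, Finset.mem_insert]
    omega
  have hna : lo ∉ Finset.Ico (lo + 1) hi := by simp
  rw [e1]
  apply Finset.sum_congr rfl
  intro S hS
  rw [Finset.mem_powerset] at hS
  rw [hins, Finset.prod_insert hna]
  have h0 : lo ∉ S := fun h => hna (hS h)
  have i1 : ind S lo = 0 := by simp [ind, h0]
  rw [i1]

/-! ### From signatures to subsets -/

/-- tuples with all parts in `[lo, hi)` -/
def box (n : ℕ) (lo hi : ℤ) : Finset (Fin n → ℤ) :=
  Fintype.piFinset fun _ => Finset.Ico lo hi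

lemma mem_box {n : ℕ} {lo hi : ℤ} {z : Fin n → ℤ} :
    z ∈ box n lo hi ↔ ∀ i, lo ≤ z i ∧ z i < hi := by
  simp [box, Fintype.mem_piFinset]

lemma sig_sum {R : Type} [CommRing R] (n : ℕ) (lo hi : ℤ) (B : ℤ → ℤ) (ε : ℤ)
    (hε : ε = 1 ∨ ε = -1) (hBlo : ∀ c ≤ lo, B c = n) (hBhi : ∀ c, hi ≤ c → B c = 0)
    (G : (ℤ → ℤ) → R) :
    ∑ z ∈ box n lo hi, (if IsSig z ∧ ∀ c, (cnt z c : ℤ) = B c ∨ (cnt z c : ℤ) = B c + ε then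
      G (fun c => (cnt z c : ℤ)) else 0)
    = ∑ S ∈ (Finset.Ioo lo hi).powerset,
      if ∀ c, B (c + 1) + ε * ind S (c + 1) ≤ B c + ε * ind S c then
        G (fun c => B c + ε * ind S c) else 0 := by
  rw [← Finset.sum_filter, ← Finset.sum_filter]
  have key : ∀ z ∈ Finset.filter (fun z => IsSig z ∧ ∀ c, (cnt z c : ℤ) = B c ∨
      (cnt z c : ℤ) = B c + ε) (box n lo hi), ∀ c,
      B c + ε * ind ((Finset.Ioo lo hi).filter (fun c => (cnt z c : ℤ) ≠ B c)) c = cnt z c := by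
    intro z hz c
    simp only [Finset.mem_filter, mem_box] at hz
    obtain ⟨hb, hs, hc⟩ := hz
    unfold ind
    by_cases h1 : lo < c ∧ c < hi
    · by_cases h2 : (cnt z c : ℤ) = B c
      · simp [h2]
      · rw [if_pos (by simp [h1, h2])]
        rcases hc c with h | h
        · exact absurd h h2
        · rw [h]; ring
    · rw [if_neg (by simp only [Finset.mem_filter, Finset.mem_Ioo]; tauto)]
      by_cases h3 : c ≤ lo
      · rw [hBlo c h3, cnt_low z c (fun i => h3.trans (hb i).1)]; ring
      · have h4 : hi ≤ c := by omega
        rw [hBhi c h4, cnt_high z c (fun i => (hb i).2.trans_le h4)]; simp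
  refine Finset.sum_bij
    (fun z _ => (Finset.Ioo lo hi).filter (fun c => (cnt z c : ℤ) ≠ B c)) ?_ ?_ ?_ ?_
  · intro z hz
    rw [Finset.mem_filter, Finset.mem_powerset]
    refine ⟨Finset.filter_subset _ _, ?_⟩
    intro c
    rw [key z hz, key z hz]
    exact_mod_cast cnt_anti z c
  · intro z hz z' hz' hzz
    have hs := (Finset.mem_filter.1 hz).2.1
    have hs' := (Finset.mem_filter.1 hz').2.1
    apply sig_ext hs hs'
    intro c
    have h1 := key z hz c
    have h2 := key z' hz' c
    rw [hzz] at h1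
    rw [h1] at h2
    exact_mod_cast h2
  · intro S hS
    rw [Finset.mem_filter, Finset.mem_powerset] at hS
    obtain ⟨hS1, hS2⟩ := hS
    have i0 : ∀ c, ¬ (lo < c ∧ c < hi) → ind S c = 0 := by
      intro c hc
      unfold ind
      rw [if_neg]
      intro h
      exact hc (Finset.mem_Ioo.1 (hS1 h))
    have hanti : Antitone (fun c => B c + ε * ind S c) := antitone_int_of_succ_le hS2
    have hnn : ∀ c, 0 ≤ B c + ε * ind S c := by
      intro c
      have h1 : B (max c hi) + ε * ind S (max c hi) ≤ B c + ε * ind S c :=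
        hanti (le_max_left c hi)
      rw [i0 (max c hi) (by omega), hBhi _ (le_max_right _ _)] at h1
      simpa using h1
    have hN : ∀ c, (((B c + ε * ind S c).toNat : ℕ) : ℤ) = B c + ε * ind S c := fun c =>
      Int.toNat_of_nonneg (hnn c)
    obtain ⟨z, hz1, hz2, hz3⟩ := exists_sig n (fun c => (B c + ε * ind S c).toNat) lo hi
      (by intro c hc; rw [i0 c (by omega), hBlo c hc]; simp)
      (by intro c hc; rw [i0 c (by omega), hBhi c hc]; simp)
      (by intro c; have := hS2 c; omega)
    have hz4 : ∀ c, (cnt z c : ℤ) = B c + ε * ind S c := by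
      intro c; rw [hz3, hN]
    have hzm : z ∈ Finset.filter (fun z => IsSig z ∧ ∀ c, (cnt z c : ℤ) = B c ∨
      (cnt z c : ℤ) = B c + ε) (box n lo hi) := by
      rw [Finset.mem_filter, mem_box]
      refine ⟨hz2, hz1, ?_⟩
      intro c
      rw [hz4]
      unfold ind
      split_ifs
      · right; ring
      · left; ring
    refine ⟨z, hzm, ?_⟩
    ext c
    simp only [Finset.mem_filter, hz4]
    constructor
    · rintro ⟨_, h⟩
      by_contra hc
      simp [ind, hc] at h
    · intro h
      refine ⟨hS1 h, ?_⟩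
      simp only [ind, h, if_true]
      omega
  · intro z hz
    congr 1
    funext c
    exact (key z hz c).symm

lemma phi_prod {K : Type} [Field K] {p : ℕ} (t : K) (l ν : Fin p → ℤ) (lo hi : ℤ)
    (hl : ∀ i, lo ≤ l i ∧ l i < hi) :
    phiHL t l ν = ∏ c ∈ Finset.Ico lo hi,
      if mcount l c = mcount ν c + 1 then 1 - t ^ mcount l c else 1 := by
  unfold phiHL
  apply finprod_eq_prod_of_mulSupport_subset
  intro c hc
  rw [Function.mem_mulSupport] at hc
  by_contra hn
  apply hc
  rw [if_neg]
  rw [mcount_zero l c]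
  · omega
  · rintro i rfl
    exact hn (by simpa using hl i)

lemma psi_prod {K : Type} [Field K] {p : ℕ} (t : K) (l : Fin (p + 1) → ℤ) (μ : Fin p → ℤ)
    (lo hi : ℤ) (hμ : ∀ i, lo ≤ μ i ∧ μ i < hi) :
    psiHL t l μ = ∏ c ∈ Finset.Ico lo hi,
      if mcount μ c = mcount l c + 1 then 1 - t ^ mcount μ c else 1 := by
  unfold psiHL
  apply finprod_eq_prod_of_mulSupport_subset
  intro c hc
  rw [Function.mem_mulSupport] at hc
  by_contra hn
  apply hc
  rw [if_neg]
  rw [mcount_zero μ c]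
  · omega
  · rintro i rfl
    exact hn (by simpa using hμ i)

open Polynomial in
lemma upper_sum {K : Type} [Field K] (t : K) (u : K[X]) {m : ℕ} (l : Fin (m + 1) → ℤ)
    (μ : Fin m → ℤ) (lo hi : ℤ) (hlh : lo < hi) (hls : IsSig l) (hμs : IsSig μ)
    (hl : ∀ i, lo ≤ l i ∧ l i < hi) (hμ : ∀ i, lo ≤ μ i ∧ μ i < hi) :
    ∑ z ∈ box (m + 1) lo hi, (if interQ l z ∧ interP μ z then
      C (phiHL t z l * psiHL t z μ) * u ^ (sumz z - sumz l).toNat else 0)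
    = tvec (fun c => wL (C t) u (mcount l c) (mcount μ c) ((cnt l c : ℤ) - cnt μ c)) hi
        (hi - lo).toNat 0 := by
  rw [← powerset_transfer' _ _ _ hlh]
  have := sig_sum (m + 1) lo hi (fun c => (cnt l c : ℤ)) 1 (Or.inl rfl)
    (fun c hc => by rw [cnt_low l c (fun i => hc.trans (hl i).1)])
    (fun c hc => by rw [cnt_high l c (fun i => (hl i).2.trans_le hc)]; rfl)
    (fun N => ∏ c ∈ Finset.Ico lo hi, if (N c - cnt μ c = 0 ∨ N c - cnt μ c = 1) then
      Fw (C t) (mcount l c) (mcount μ c) (N c - N (c + 1)) * u ^ (N c - cnt l c).toNat else 0)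
  beta_reduce at this
  refine Eq.trans ?_ (this.trans ?_)
  · apply Finset.sum_congr rfl
    intro z hz
    rw [mem_box] at hz
    by_cases hQ : interQ l z
    · have hzs := interQ_sig_right hQ
      have hQ' := (interQ_iff hls hzs).1 hQ
      rw [if_pos (c := IsSig z ∧ _) ⟨hzs, fun c => by have := hQ' c; omega⟩]
      by_cases hP : interP μ z
      · have hP' := (interP_iff hμs hzs).1 hP
        rw [if_pos ⟨hQ, hP⟩]
        rw [Finset.prod_congr rfl (fun c _ => if_pos (by have := hP' c; omega)),
          Finset.prod_mul_distrib, Finset.prod_pow_eq_pow_sum]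
        congr 1
        · rw [phi_prod t z l lo hi hz, psi_prod t z μ lo hi hμ, ← Finset.prod_mul_distrib, map_prod]
          apply Finset.prod_congr rfl
          intro c _
          have h1 : (cnt z c : ℤ) - cnt z (c + 1) = mcount z c := by
            have := cnt_eq z c; omega
          rw [h1, Fw, map_mul]
          congr 1
          · by_cases h : mcount z c = mcount l c + 1
            · rw [if_pos h, if_pos (by omega), h]; simp
            · rw [if_neg h, if_neg (by omega)]; simp
          · by_cases h : mcount μ c = mcount z c + 1
            · rw [if_pos h, if_pos (by omega)]; simp
            · rw [if_neg h, if_neg (by omega)]; simp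
        · congr 1
          have : (((∑ c ∈ Finset.Ico lo hi, ((cnt z c : ℤ) - cnt l c).toNat : ℕ)) : ℤ) =
              sumz z - sumz l := by
            rw [sumz_eq_cnt z lo hi hz, sumz_eq_cnt l lo hi hl, Nat.cast_sum]
            have e1 : Finset.Ico lo hi = insert lo (Finset.Ioo lo hi) := by
              ext c; simp only [Finset.mem_Ico, Finset.mem_insert, Finset.mem_Ioo]; omega
            rw [e1, Finset.sum_insert (by simp), cnt_low z lo (fun i => (hz i).1),
              cnt_low l lo (fun i => (hl i).1)]
            rw [Finset.sum_congr rfl (fun c _ => Int.toNat_of_nonneg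
              (by have := hQ' c; omega : (0 : ℤ) ≤ (cnt z c : ℤ) - cnt l c))]
            rw [Finset.sum_sub_distrib]
            simp
          rw [← this, Int.toNat_natCast]
      · rw [if_neg (fun h => hP h.2)]
        symm
        rw [interP_iff hμs hzs] at hP
        push Not at hP
        obtain ⟨c, hc1, hc2⟩ := hP
        apply Finset.prod_eq_zero (i := c)
        · rw [Finset.mem_Ico]
          by_contra hc
          by_cases h3 : c ≤ lo
          · have e1 := cnt_low z c (fun i => h3.trans (hz i).1)
            have e2 := cnt_low μ c (fun i => h3.trans (hμ i).1)
            omega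
          · have h4 : hi ≤ c := by omega
            have e1 := cnt_high z c (fun i => (hz i).2.trans_le h4)
            have e2 := cnt_high μ c (fun i => (hμ i).2.trans_le h4)
            omega
        · rw [if_neg]; omega
    · rw [if_neg (fun h => hQ h.1), if_neg]
      rintro ⟨hzs, h⟩
      exact hQ ((interQ_iff hls hzs).2 (fun c => by have := h c; omega))
  · apply Finset.sum_congr rfl
    intro S hS
    rw [Finset.mem_powerset] at hS
    have i0 : ∀ c, ¬ (lo < c ∧ c < hi) → ind S c = 0 := by
      intro c hc
      unfold ind
      rw [if_neg]
      intro h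
      exact hc (Finset.mem_Ioo.1 (hS h))
    split_ifs with hA
    · apply Finset.prod_congr rfl
      intro c _
      have h1 := cnt_eq l c
      have h2 := hA c
      unfold wL
      have e1 : (cnt l c : ℤ) + 1 * ind S c - ((cnt l (c + 1) : ℤ) + 1 * ind S (c + 1)) =
        mcount l c + ind S c - ind S (c + 1) := by omega
      have e2 : (cnt l c : ℤ) + 1 * ind S c - cnt l c = ind S c := by ring
      have e3 : (cnt l c : ℤ) + 1 * ind S c - cnt μ c = cnt l c - cnt μ c + ind S c := by ring
      simp only [e1, e2, e3]
      refine if_congr ?_ rfl rfl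
      constructor
      · intro h; exact ⟨by omega, h⟩
      · exact fun h => h.2
    · push Not at hA
      obtain ⟨c, hc⟩ := hA
      symm
      have h1 := cnt_eq l c
      apply Finset.prod_eq_zero (i := c)
      · rw [Finset.mem_Ico]
        by_contra hcc
        rw [i0 c (by omega), i0 (c + 1) (by omega)] at hc
        omega
      · unfold wL
        rw [if_neg]
        omega

open Polynomial in
lemma lower_sum {K : Type} [Field K] (t : K) (u : K[X]) {m : ℕ} (l : Fin (m + 1) → ℤ)
    (μ : Fin m → ℤ) (lo hi : ℤ) (hlh : lo < hi) (hls : IsSig l) (hμs : IsSig μ)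
    (hl : ∀ i, lo ≤ l i ∧ l i < hi) (hμ : ∀ i, lo ≤ μ i ∧ μ i < hi) :
    ∑ z ∈ box m lo hi, (if interP z l ∧ interQ z μ then
      C (psiHL t l z * phiHL t μ z) * u ^ (sumz μ - sumz z).toNat else 0)
    = tvec (fun c => wR (C t) u (mcount l c) (mcount μ c) ((cnt l c : ℤ) - cnt μ c)) hi
        (hi - lo).toNat 0 := by
  rw [← powerset_transfer' _ _ _ hlh]
  have := sig_sum m lo hi (fun c => (cnt μ c : ℤ)) (-1) (Or.inr rfl)
    (fun c hc => by rw [cnt_low μ c (fun i => hc.trans (hμ i).1)])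
    (fun c hc => by rw [cnt_high μ c (fun i => (hμ i).2.trans_le hc)]; rfl)
    (fun N => ∏ c ∈ Finset.Ico lo hi, if (cnt l c - N c = 0 ∨ cnt l c - N c = 1) then
      Fw (C t) (mcount l c) (mcount μ c) (N c - N (c + 1)) * u ^ (cnt μ c - N c).toNat else 0)
  beta_reduce at this
  refine Eq.trans ?_ (this.trans ?_)
  · apply Finset.sum_congr rfl
    intro z hz
    rw [mem_box] at hz
    by_cases hQ : interQ z μ
    · have hzs := interQ_sig_left hQ
      have hQ' := (interQ_iff hzs hμs).1 hQ
      rw [if_pos (c := IsSig z ∧ _) ⟨hzs, fun c => by have := hQ' c; omega⟩]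
      by_cases hP : interP z l
      · have hP' := (interP_iff hzs hls).1 hP
        rw [if_pos ⟨hP, hQ⟩]
        rw [Finset.prod_congr rfl (fun c _ => if_pos (by have := hP' c; omega)),
          Finset.prod_mul_distrib, Finset.prod_pow_eq_pow_sum]
        congr 1
        · rw [phi_prod t μ z lo hi hμ, psi_prod t l z lo hi hz, ← Finset.prod_mul_distrib, map_prod]
          apply Finset.prod_congr rfl
          intro c _
          have h1 : (cnt z c : ℤ) - cnt z (c + 1) = mcount z c := by
            have := cnt_eq z c; omega
          rw [h1, Fw, map_mul]
          congr 1
          · by_cases h : mcount z c = mcount l c + 1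
            · rw [if_pos h, if_pos (by omega), h]; simp
            · rw [if_neg h, if_neg (by omega)]; simp
          · by_cases h : mcount μ c = mcount z c + 1
            · rw [if_pos h, if_pos (by omega)]; simp
            · rw [if_neg h, if_neg (by omega)]; simp
        · congr 1
          have : (((∑ c ∈ Finset.Ico lo hi, ((cnt μ c : ℤ) - cnt z c).toNat : ℕ)) : ℤ) =
              sumz μ - sumz z := by
            rw [sumz_eq_cnt z lo hi hz, sumz_eq_cnt μ lo hi hμ, Nat.cast_sum]
            have e1 : Finset.Ico lo hi = insert lo (Finset.Ioo lo hi) := by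
              ext c; simp only [Finset.mem_Ico, Finset.mem_insert, Finset.mem_Ioo]; omega
            rw [e1, Finset.sum_insert (by simp), cnt_low z lo (fun i => (hz i).1),
              cnt_low μ lo (fun i => (hμ i).1)]
            rw [Finset.sum_congr rfl (fun c _ => Int.toNat_of_nonneg
              (by have := hQ' c; omega : (0 : ℤ) ≤ (cnt μ c : ℤ) - cnt z c))]
            rw [Finset.sum_sub_distrib]
            simp
          rw [← this, Int.toNat_natCast]
      · rw [if_neg (fun h => hP h.1)]
        symm
        rw [interP_iff hzs hls] at hP
        push Not at hP
        obtain ⟨c, hc1, hc2⟩ := hP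
        apply Finset.prod_eq_zero (i := c)
        · rw [Finset.mem_Ico]
          by_contra hc
          by_cases h3 : c ≤ lo
          · have e1 := cnt_low z c (fun i => h3.trans (hz i).1)
            have e2 := cnt_low l c (fun i => h3.trans (hl i).1)
            omega
          · have h4 : hi ≤ c := by omega
            have e1 := cnt_high z c (fun i => (hz i).2.trans_le h4)
            have e2 := cnt_high l c (fun i => (hl i).2.trans_le h4)
            omega
        · rw [if_neg]; omega
    · rw [if_neg (fun h => hQ h.2), if_neg]
      rintro ⟨hzs, h⟩
      exact hQ ((interQ_iff hzs hμs).2 (fun c => by have := h c; omega))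
  · apply Finset.sum_congr rfl
    intro S hS
    rw [Finset.mem_powerset] at hS
    have i0 : ∀ c, ¬ (lo < c ∧ c < hi) → ind S c = 0 := by
      intro c hc
      unfold ind
      rw [if_neg]
      intro h
      exact hc (Finset.mem_Ioo.1 (hS h))
    split_ifs with hA
    · apply Finset.prod_congr rfl
      intro c _
      have h1 := cnt_eq μ c
      have h2 := hA c
      unfold wR
      have e1 : (cnt μ c : ℤ) + -1 * ind S c - ((cnt μ (c + 1) : ℤ) + -1 * ind S (c + 1)) =
        mcount μ c - ind S c + ind S (c + 1) := by omega
      have e2 : (cnt μ c : ℤ) - (cnt μ c + -1 * ind S c) = ind S c := by ring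
      have e3 : (cnt l c : ℤ) - (cnt μ c + -1 * ind S c) = cnt l c - cnt μ c + ind S c := by ring
      simp only [e1, e2, e3]
      refine if_congr ?_ rfl rfl
      constructor
      · intro h; exact ⟨by omega, h⟩
      · exact fun h => h.2
    · push Not at hA
      obtain ⟨c, hc⟩ := hA
      symm
      have h1 := cnt_eq μ c
      apply Finset.prod_eq_zero (i := c)
      · rw [Finset.mem_Ico]
        by_contra hcc
        rw [i0 c (by omega), i0 (c + 1) (by omega)] at hc
        omega
      · unfold wR
        rw [if_neg]
        omega

open Polynomial in
lemma local_cauchy {K : Type} [Field K] (t : K) (u : K[X]) {m : ℕ} (l : Fin (m + 1) → ℤ)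
    (μ : Fin m → ℤ) (lo hi : ℤ) (hls : IsSig l) (hμs : IsSig μ)
    (hl : ∀ i, lo ≤ l i ∧ l i < hi) (hμ : ∀ i, lo ≤ μ i ∧ μ i < hi) (D : ℕ)
    (hD : l 0 + D < hi) :
    u ^ D ∣ (1 - u) * (∑ z ∈ box (m + 1) lo hi, (if interQ l z ∧ interP μ z then
        C (phiHL t z l * psiHL t z μ) * u ^ (sumz z - sumz l).toNat else 0))
      - (1 - C t * u) * (∑ z ∈ box m lo hi, (if interP z l ∧ interQ z μ then
        C (psiHL t l z * phiHL t μ z) * u ^ (sumz μ - sumz z).toNat else 0)) := by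
  have h0 := hl 0
  have hlh : lo < hi := by omega
  rw [upper_sum t u l μ lo hi hlh hls hμs hl hμ, lower_sum t u l μ lo hi hlh hls hμs hl hμ]
  obtain ⟨E, h1, -, h3⟩ := tvec_rel (C t) u (mcount l) (mcount μ)
    (fun c => (cnt l c : ℤ) - cnt μ c) hi (l 0)
    (by intro c
        have := cnt_eq l c
        have := cnt_eq μ c
        omega)
    (by simp [cnt_high l hi (fun i => (hl i).2), cnt_high μ hi (fun i => (hμ i).2)])
    (by intro c hc
        apply mcount_zero
        intro i
        have := hls 0 i (Fin.zero_le i)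
        omega)
    D hD (hi - lo).toNat
  have hlo : hi - ((hi - lo).toNat : ℤ) = lo := by omega
  rw [hlo] at h1 h3
  obtain ⟨-, h4, -⟩ := h1
  obtain ⟨h5, -⟩ := h4 (by
    simp [cnt_low l lo (fun i => (hl i).1), cnt_low μ lo (fun i => (hμ i).1)])
  rw [h5]
  obtain ⟨q, hq⟩ := (h3 h0.1).1
  exact ⟨-q, by rw [hq]; ring⟩

lemma dvd_of_dvd_of_eq {R : Type} [CommRing R] {a b c : R} (h : a ∣ b) (e : b = c) : a ∣ c :=
  e ▸ h

/-! ### Branching in boxes -/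

lemma HLPfull_zero {K : Type} [Field K] (t : K) (l : Fin 0 → ℤ) (x : Fin 0 → K) :
    HLPfull t l x = 1 := by
  unfold HLPfull HLP
  rw [if_pos]
  exact Subsingleton.elim _ _

lemma branch_cast {K : Type} [Field K] (t y : K) (n N : ℕ) (h : N = n) (l : Fin (n + 1) → ℤ)
    (G : (Fin N → ℤ) → K) :
    (∑ᶠ ν : Fin N → ℤ, if interP ν (fun i => l (Fin.cast (by rw [h]) i)) then
      psiHL t (fun i => l (Fin.cast (by rw [h]) i)) ν *
        y ^ (sumz (fun i : Fin (N + 1) => l (Fin.cast (by rw [h]) i)) - sumz ν) * G ν else 0) =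
    ∑ᶠ ν : Fin n → ℤ, if interP ν l then
      psiHL t l ν * y ^ (sumz l - sumz ν) * G (fun i => ν (Fin.cast h i)) else 0 := by
  subst h
  rfl

lemma HLPfull_succ {K : Type} [Field K] (t : K) (n : ℕ) (l : Fin (n + 1) → ℤ)
    (x : Fin (n + 1) → K) :
    HLPfull t l x = ∑ᶠ ν : Fin n → ℤ, if interP ν l then
      psiHL t l ν * x (Fin.last n) ^ (sumz l - sumz ν) *
        HLPfull t ν (fun i => x i.castSucc) else 0 := by
  exact branch_cast t (x (Fin.last n)) n (0 + n) (Nat.zero_add n) l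
    (fun ν => HLP t n (fun i : Fin 0 => 0) ν (fun i => x i.castSucc))

lemma HLPfull_box {K : Type} [Field K] (t : K) (n : ℕ) (l : Fin (n + 1) → ℤ)
    (x : Fin (n + 1) → K) (lo hi : ℤ) (hl : ∀ i, lo ≤ l i ∧ l i < hi) :
    HLPfull t l x = ∑ ν ∈ box n lo hi, if interP ν l then
      psiHL t l ν * x (Fin.last n) ^ (sumz l - sumz ν) *
        HLPfull t ν (fun i => x i.castSucc) else 0 := by
  rw [HLPfull_succ]
  apply finsum_eq_sum_of_support_subset
  intro ν hν
  rw [Function.mem_support] at hν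
  have hP : interP ν l := by
    by_contra h
    exact hν (if_neg h)
  rw [Finset.mem_coe, mem_box]
  intro i
  exact ⟨(hl _).1.trans (hP i).2, (hP i).1.trans_lt (hl _).2⟩

lemma HLQ_ne_zero {K : Type} [Field K] (t : K) {n : ℕ} (ν : Fin n → ℤ) (hν : IsSig ν) (k : ℕ) :
    ∀ (l : Fin n → ℤ) (y : Fin k → K), HLQ t k ν l y ≠ 0 → IsSig l ∧ ∀ i, ν i ≤ l i := by
  induction k with
  | zero =>
    intro l y h
    unfold HLQ at h
    have : ν = l := by
      by_contra hc
      exact h (if_neg hc)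
    subst this
    exact ⟨hν, fun _ => le_rfl⟩
  | succ k ih =>
    intro l y h
    unfold HLQ at h
    have hex : ∃ κ : Fin n → ℤ, (if interQ κ l then
        phiHL t l κ * y (Fin.last k) ^ (sumz l - sumz κ) * HLQ t k ν κ fun i => y i.castSucc
      else 0) ≠ 0 := by
      by_contra hc
      push Not at hc
      exact h ((finsum_congr hc).trans finsum_zero)
    obtain ⟨κ, hκ⟩ := hex
    have hQ : interQ κ l := by
      by_contra hc
      exact hκ (if_neg hc)
    rw [if_pos hQ] at hκ
    obtain ⟨-, h2⟩ := ih κ _ (right_ne_zero_of_mul hκ)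
    exact ⟨interQ_sig_right hQ, fun i => (h2 i).trans (hQ.1 i)⟩

lemma HLQ_box {K : Type} [Field K] (t : K) {n : ℕ} (k : ℕ) (ν l : Fin n → ℤ) (hνs : IsSig ν)
    (y : Fin (k + 1) → K) (lo hi : ℤ) (hν : ∀ i, lo ≤ ν i) (hl : ∀ i, l i < hi) :
    HLQ t (k + 1) ν l y = ∑ κ ∈ box n lo hi, if interQ κ l then
        phiHL t l κ * y (Fin.last k) ^ (sumz l - sumz κ) * HLQ t k ν κ (fun i => y i.castSucc)
      else 0 := by
  conv_lhs => unfold HLQ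
  apply finsum_eq_sum_of_support_subset
  intro κ hκ
  rw [Function.mem_support] at hκ
  have hQ : interQ κ l := by
    by_contra h
    exact hκ (if_neg h)
  rw [if_pos hQ] at hκ
  obtain ⟨-, h2⟩ := HLQ_ne_zero t ν hνs k κ _ (right_ne_zero_of_mul hκ)
  rw [Finset.mem_coe, mem_box]
  intro i
  exact ⟨(hν i).trans (h2 i), (hQ.1 i).trans_lt (hl i)⟩

lemma sumz_mono {n : ℕ} {ν l : Fin n → ℤ} (h : ∀ i, ν i ≤ l i) : sumz ν ≤ sumz l :=
  Finset.sum_le_sum fun i _ => h i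

open Polynomial in
lemma local_cauchy' {K : Type} [Field K] (t : K) (u : K[X]) {m : ℕ} (l : Fin (m + 1) → ℤ)
    (μ : Fin m → ℤ) (lo hi : ℤ) (hls : IsSig l)
    (hl : ∀ i, lo ≤ l i ∧ l i < hi) (hμ : ∀ i, lo ≤ μ i ∧ μ i < hi) (D : ℕ)
    (hD : l 0 + D < hi) :
    u ^ D ∣ (1 - u) * (∑ z ∈ box (m + 1) lo hi, (if interQ l z ∧ interP μ z then
        C (phiHL t z l * psiHL t z μ) * u ^ (sumz z - sumz l).toNat else 0))
      - (1 - C t * u) * (∑ z ∈ box m lo hi, (if interP z l ∧ interQ z μ then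
        C (psiHL t l z * phiHL t μ z) * u ^ (sumz μ - sumz z).toNat else 0)) := by
  by_cases hμs : IsSig μ
  · exact local_cauchy t u l μ lo hi hls hμs hl hμ D hD
  · rw [Finset.sum_eq_zero, Finset.sum_eq_zero]
    · simp
    · intro z _
      exact if_neg fun h => hμs (interQ_sig_right h.2)
    · intro z _
      exact if_neg fun h => hμs (interP_sig_left h.2)

/-! ### The one-variable Cauchy identity (truncated) -/

open Polynomial in
/-- truncated left-hand side of the one-variable skew Cauchy identity -/
def cauchyOne {K : Type} [Field K] (t y : K) (Z : K[X]) {n : ℕ} (x : Fin n → K) (lo hi : ℤ)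
    (l : Fin n → ℤ) : K[X] :=
  ∑ z ∈ box n lo hi, if interQ l z then
    C (phiHL t z l * y ^ (sumz z - sumz l).toNat * HLPfull t z x) * Z ^ (sumz z - sumz l).toNat
  else 0

open Polynomial in
lemma cauchyOne_rel {K : Type} [Field K] (t y : K) (Z : K[X]) (lo hi : ℤ) (D : ℕ) (n : ℕ) :
    ∀ (x : Fin n → K), (∀ i, x i ≠ 0) → ∀ l : Fin n → ℤ, IsSig l → (∀ i, lo ≤ l i ∧ l i + D < hi) →
    Z ^ D ∣ (∏ i, (1 - C (x i * y) * Z)) * cauchyOne t y Z x lo hi l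
      - (∏ i, (1 - C (t * (x i * y)) * Z)) * C (HLPfull t l x) := by
  induction n with
  | zero =>
    intro x hx l hls hl
    have : cauchyOne t y Z x lo hi l = 1 := by
      unfold cauchyOne
      have hb : box 0 lo hi = {l} := by
        ext z
        simp [mem_box, Subsingleton.elim z l]
      rw [hb, Finset.sum_singleton, if_pos ⟨fun i => i.elim0, fun i => i.elim0⟩,
        phi_prod t l l lo lo (fun i => i.elim0)]
      simp [HLPfull_zero]
    rw [this, HLPfull_zero]
    simp
  | succ n ih =>
    intro x hx l hls hl
    set xl := x (Fin.last n) with hxl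
    have hxl0 : xl ≠ 0 := hx _
    set x' : Fin n → K := fun i => x i.castSucc with hx'
    set u : K[X] := C (xl * y) * Z with hu
    have hl' : ∀ i, lo ≤ l i ∧ l i < hi := fun i => ⟨(hl i).1, by have := (hl i).2; omega⟩
    set W : (Fin n → ℤ) → K[X] := fun μ => C (xl ^ (sumz l - sumz μ) * HLPfull t μ x') with hW
    have hA : cauchyOne t y Z x lo hi l = ∑ μ ∈ box n lo hi, W μ *
        (∑ z ∈ box (n + 1) lo hi, (if interQ l z ∧ interP μ z then
        C (phiHL t z l * psiHL t z μ) * u ^ (sumz z - sumz l).toNat else 0)) := by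
      simp only [Finset.mul_sum]
      rw [Finset.sum_comm]
      unfold cauchyOne
      apply Finset.sum_congr rfl
      intro z hz
      rw [mem_box] at hz
      by_cases hQ : interQ l z
      · rw [if_pos hQ, HLPfull_box t n z x lo hi hz, Finset.mul_sum, map_sum, Finset.sum_mul]
        apply Finset.sum_congr rfl
        intro μ _
        by_cases hP : interP μ z
        · rw [if_pos hP, if_pos ⟨hQ, hP⟩]
          have hge := sumz_mono hQ.1
          obtain ⟨d, hd⟩ := Int.eq_ofNat_of_zero_le (sub_nonneg.2 hge)
          have e1 : sumz z - sumz μ = (sumz l - sumz μ) + d := by omega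
          rw [e1, zpow_add₀ hxl0, hd, hu, hW]
          simp only [Int.toNat_natCast, zpow_natCast, mul_pow, map_mul, map_pow]
          ring
        · rw [if_neg hP, if_neg (fun h => hP h.2)]
          simp
      · rw [if_neg hQ]
        symm
        apply Finset.sum_eq_zero
        intro μ _
        rw [if_neg (fun h => hQ h.1), mul_zero]
    have hB : ∑ μ ∈ box n lo hi, W μ * (∑ z ∈ box n lo hi, (if interP z l ∧ interQ z μ then
        C (psiHL t l z * phiHL t μ z) * u ^ (sumz μ - sumz z).toNat else 0)) =
        ∑ z ∈ box n lo hi, if interP z l then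
          C (psiHL t l z * xl ^ (sumz l - sumz z)) * cauchyOne t y Z x' lo hi z else 0 := by
      simp only [Finset.mul_sum]
      rw [Finset.sum_comm]
      apply Finset.sum_congr rfl
      intro z _
      by_cases hP : interP z l
      · rw [if_pos hP]
        unfold cauchyOne
        rw [Finset.mul_sum]
        apply Finset.sum_congr rfl
        intro μ _
        by_cases hQ : interQ z μ
        · rw [if_pos hQ, if_pos ⟨hP, hQ⟩]
          have hge := sumz_mono hQ.1
          obtain ⟨d, hd⟩ := Int.eq_ofNat_of_zero_le (sub_nonneg.2 hge)
          have e1 : sumz l - sumz z = (sumz l - sumz μ) + d := by omega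
          rw [e1, zpow_add₀ hxl0, hd, hu, hW]
          simp only [Int.toNat_natCast, zpow_natCast, mul_pow, map_mul, map_pow]
          ring
        · rw [if_neg hQ, if_neg (fun h => hQ h.2)]
          simp
      · rw [if_neg hP]
        apply Finset.sum_eq_zero
        intro μ _
        rw [if_neg (fun h => hP h.1), mul_zero]
    have hZu : Z ^ D ∣ u ^ D := pow_dvd_pow_of_dvd (Dvd.intro_left _ rfl) D
    have d1 : Z ^ D ∣ (1 - u) * cauchyOne t y Z x lo hi l - (1 - C t * u) *
        (∑ z ∈ box n lo hi, if interP z l then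
          C (psiHL t l z * xl ^ (sumz l - sumz z)) * cauchyOne t y Z x' lo hi z else 0) := by
      rw [← hB, hA, Finset.mul_sum, Finset.mul_sum, ← Finset.sum_sub_distrib]
      apply Finset.dvd_sum
      intro μ hμ
      rw [mem_box] at hμ
      have := (hZu.trans (local_cauchy' t u l μ lo hi hls hl' hμ D (hl 0).2)).mul_left (W μ)
      refine dvd_of_dvd_of_eq this ?_
      ring
    have d2 : Z ^ D ∣ (∏ i, (1 - C (x' i * y) * Z)) * (∑ z ∈ box n lo hi, if interP z l then
          C (psiHL t l z * xl ^ (sumz l - sumz z)) * cauchyOne t y Z x' lo hi z else 0)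
        - (∏ i, (1 - C (t * (x' i * y)) * Z)) * C (HLPfull t l x) := by
      rw [HLPfull_box t n l x lo hi hl', map_sum, Finset.mul_sum, Finset.mul_sum,
        ← Finset.sum_sub_distrib]
      apply Finset.dvd_sum
      intro z _
      by_cases hP : interP z l
      · rw [if_pos hP, if_pos hP]
        have := (ih x' (fun i => hx _) z (interP_sig_left hP) (fun i =>
          ⟨(hl _).1.trans (hP i).2, by have h1 := (hP i).1; have h2 := (hl i.castSucc).2; omega⟩)
          ).mul_left (C (psiHL t l z * xl ^ (sumz l - sumz z)))
        refine dvd_of_dvd_of_eq this ?_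
        rw [← hxl, ← hx', map_mul, map_mul, map_mul]
        ring
      · rw [if_neg hP, if_neg hP]
        simp
    rw [Fin.prod_univ_castSucc, Fin.prod_univ_castSucc]
    have := dvd_add (d1.mul_left (∏ i, (1 - C (x' i * y) * Z))) (d2.mul_left (1 - C t * u))
    refine dvd_of_dvd_of_eq this ?_
    have e3 : C (t * (x (Fin.last n) * y)) * Z = C t * u := by
      rw [hu, ← hxl, map_mul]; ring
    rw [e3, ← hxl, ← hu]
    ring

open Polynomial in
/-- the truncated multi-variable skew Cauchy identity -/
lemma cauchyMany_rel {K : Type} [Field K] (t : K) (Z : K[X]) (lo hi : ℤ) {n : ℕ}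
    (x : Fin n → K) (hx : ∀ i, x i ≠ 0) (l : Fin n → ℤ) (hls : IsSig l) (D : ℕ)
    (hl : ∀ i, lo ≤ l i ∧ l i + D < hi) (k : ℕ) :
    ∀ y : Fin k → K,
    Z ^ D ∣ (∏ j, ∏ i, (1 - C (x i * y j) * Z)) *
        (∑ z ∈ box n lo hi, C (HLQ t k l z y * HLPfull t z x) * Z ^ (sumz z - sumz l).toNat)
      - (∏ j, ∏ i, (1 - C (t * (x i * y j)) * Z)) * C (HLPfull t l x) := by
  induction k with
  | zero =>
    intro y
    have : (∑ z ∈ box n lo hi, C (HLQ t 0 l z y * HLPfull t z x) * Z ^ (sumz z - sumz l).toNat)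
        = C (HLPfull t l x) := by
      rw [Finset.sum_eq_single l]
      · simp [HLQ]
      · intro z _ hz
        have : ¬ l = z := fun h => hz h.symm
        simp [HLQ, this]
      · intro h
        exfalso
        apply h
        rw [mem_box]
        intro i
        have := hl i
        omega
    rw [this]
    simp
  | succ k ih =>
    intro y
    set yl := y (Fin.last k) with hyl
    set y' : Fin k → K := fun i => y i.castSucc with hy'
    have hA : (∑ z ∈ box n lo hi, C (HLQ t (k + 1) l z y * HLPfull t z x) *
          Z ^ (sumz z - sumz l).toNat) =
        ∑ κ ∈ box n lo hi, C (HLQ t k l κ y') * Z ^ (sumz κ - sumz l).toNat *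
          cauchyOne t yl Z x lo hi κ := by
      unfold cauchyOne
      simp only [Finset.mul_sum]
      rw [Finset.sum_comm]
      apply Finset.sum_congr rfl
      intro z hz
      rw [mem_box] at hz
      rw [HLQ_box t k l z hls y lo hi (fun i => (hl i).1) (fun i => (hz i).2), Finset.sum_mul,
        map_sum, Finset.sum_mul]
      apply Finset.sum_congr rfl
      intro κ _
      by_cases hQ : interQ κ z
      · rw [if_pos hQ, if_pos hQ]
        by_cases h0 : HLQ t k l κ y' = 0
        · rw [← hy', h0]; simp
        · have h1 := sumz_mono (HLQ_ne_zero t l hls k κ y' h0).2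
          have hge := sumz_mono hQ.1
          obtain ⟨d, hd⟩ := Int.eq_ofNat_of_zero_le (sub_nonneg.2 hge)
          obtain ⟨d', hd'⟩ := Int.eq_ofNat_of_zero_le (sub_nonneg.2 h1)
          have e1 : (sumz z - sumz l).toNat = d' + d := by omega
          rw [e1, hd, hd', ← hy', ← hyl, pow_add]
          simp only [Int.toNat_natCast, zpow_natCast, map_mul, map_pow]
          ring
      · rw [if_neg hQ, if_neg hQ]
        simp
    rw [hA, Fin.prod_univ_castSucc, Fin.prod_univ_castSucc]
    have d1 : Z ^ D ∣ (∏ i, (1 - C (x i * yl) * Z)) *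
        (∑ κ ∈ box n lo hi, C (HLQ t k l κ y') * Z ^ (sumz κ - sumz l).toNat *
          cauchyOne t yl Z x lo hi κ) - (∏ i, (1 - C (t * (x i * yl)) * Z)) *
        (∑ z ∈ box n lo hi, C (HLQ t k l z y' * HLPfull t z x) * Z ^ (sumz z - sumz l).toNat) := by
      rw [Finset.mul_sum, Finset.mul_sum, ← Finset.sum_sub_distrib]
      apply Finset.dvd_sum
      intro κ hκ
      rw [mem_box] at hκ
      by_cases h0 : HLQ t k l κ y' = 0
      · rw [h0]; simp
      obtain ⟨hκs, hκl⟩ := HLQ_ne_zero t l hls k κ y' h0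
      have h1 := sumz_mono hκl
      obtain ⟨d', hd'⟩ := Int.eq_ofNat_of_zero_le (sub_nonneg.2 h1)
      have hT : (sumz κ - sumz l).toNat = d' := by omega
      rw [hT]
      have key : Z ^ D ∣ Z ^ d' * ((∏ i, (1 - C (x i * yl) * Z)) * cauchyOne t yl Z x lo hi κ
          - (∏ i, (1 - C (t * (x i * yl)) * Z)) * C (HLPfull t κ x)) := by
        by_cases hd : D ≤ d'
        · exact (pow_dvd_pow Z hd).mul_right _
        · have e1 : D = d' + (D - d') := by omega
          have hb : ∀ i, κ i ≤ l i + d' := by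
            intro i
            have : κ i - l i ≤ ∑ j, (κ j - l j) :=
              Finset.single_le_sum (f := fun j => κ j - l j)
                (fun j _ => sub_nonneg.2 (hκl j)) (Finset.mem_univ i)
            rw [Finset.sum_sub_distrib] at this
            unfold sumz at hd'
            omega
          conv_lhs => rw [e1, pow_add]
          apply mul_dvd_mul_left
          apply cauchyOne_rel t yl Z lo hi (D - d') n x hx κ hκs
          intro i
          have h2 := hb i
          have h3 := (hl i).2
          exact ⟨(hκ i).1, by omega⟩
      refine dvd_of_dvd_of_eq (key.mul_left (C (HLQ t k l κ y'))) ?_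
      rw [map_mul]
      ring
    have d2 := ih y'
    have := dvd_add (d1.mul_left (∏ j, ∏ i, (1 - C (x i * y' j) * Z)))
      (d2.mul_left (∏ i, (1 - C (t * (x i * yl)) * Z)))
    refine dvd_of_dvd_of_eq this ?_
    rw [← hyl]
    ring

/-! ### Positivity, homogeneity, linear independence -/

lemma exists_window {p : ℕ} (s : Finset (Fin p → ℤ)) :
    ∃ lo hi : ℤ, ∀ l ∈ s, ∀ i, lo ≤ l i ∧ l i < hi := by
  refine ⟨-(∑ l ∈ s, ∑ i, |l i|), (∑ l ∈ s, ∑ i, |l i|) + 1, fun l hl i => ?_⟩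
  have h1 : |l i| ≤ ∑ i, |l i| :=
    Finset.single_le_sum (f := fun i => |l i|) (fun j _ => abs_nonneg _) (Finset.mem_univ i)
  have h2 : ∑ i, |l i| ≤ ∑ l ∈ s, ∑ i, |l i| :=
    Finset.single_le_sum (f := fun l : Fin p → ℤ => ∑ i, |l i|)
      (fun j _ => Finset.sum_nonneg fun _ _ => abs_nonneg _) hl
  have h3 := neg_abs_le (l i)
  have h4 := le_abs_self (l i)
  constructor <;> linarith

lemma psiHL_pos (q : ℝ) (hq : |q| < 1) {p : ℕ} (l : Fin (p + 1) → ℤ) (μ : Fin p → ℤ) :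
    0 < psiHL q l μ := by
  obtain ⟨lo, hi, h⟩ := exists_window {μ}
  rw [psi_prod q l μ lo hi (h μ (Finset.mem_singleton_self _))]
  apply Finset.prod_pos
  intro c _
  split_ifs with hm
  · have h1 : |q ^ mcount μ c| < 1 := by
      rw [abs_pow]
      exact pow_lt_one₀ (abs_nonneg _) hq (by omega)
    have := (abs_lt.1 h1).2
    linarith
  · exact one_pos

lemma interP_castSucc {n : ℕ} {l : Fin (n + 1) → ℤ} (hl : IsSig l) :
    interP (fun i => l i.castSucc) l :=
  fun i => ⟨le_rfl, hl _ _ (Fin.castSucc_lt_succ).le⟩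

lemma HLPfull_pos (q : ℝ) (hq : |q| < 1) (n : ℕ) : ∀ (l : Fin n → ℤ), IsSig l →
    ∀ x : Fin n → ℝ, (∀ i, 0 < x i) → 0 < HLPfull q l x := by
  induction n with
  | zero => intro l _ x _; rw [HLPfull_zero]; exact one_pos
  | succ n ih =>
    intro l hl x hx
    obtain ⟨lo, hi, h⟩ := exists_window {l}
    have h := h l (Finset.mem_singleton_self _)
    rw [HLPfull_box q n l x lo hi h]
    have hpos : ∀ ν, interP ν l → 0 < psiHL q l ν * x (Fin.last n) ^ (sumz l - sumz ν) *
        HLPfull q ν (fun i => x i.castSucc) := fun ν hν =>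
      mul_pos (mul_pos (psiHL_pos q hq l ν) (zpow_pos (hx _) _))
        (ih ν (interP_sig_left hν) _ fun i => hx _)
    apply Finset.sum_pos'
    · intro ν _
      split_ifs with hν
      · exact (hpos ν hν).le
      · exact le_rfl
    · refine ⟨fun i => l i.castSucc, ?_, ?_⟩
      · rw [mem_box]; exact fun i => h _
      · rw [if_pos (interP_castSucc hl)]
        exact hpos _ (interP_castSucc hl)

lemma HLPfull_homog {K : Type} [Field K] (q z : K) (hz : z ≠ 0) (n : ℕ) :
    ∀ (l : Fin n → ℤ) (x : Fin n → K),
    HLPfull q l (fun i => z * x i) = z ^ (sumz l) * HLPfull q l x := by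
  induction n with
  | zero => intro l x; rw [HLPfull_zero, HLPfull_zero]; simp [sumz]
  | succ n ih =>
    intro l x
    obtain ⟨lo, hi, h⟩ := exists_window {l}
    have h := h l (Finset.mem_singleton_self _)
    rw [HLPfull_box q n l _ lo hi h, HLPfull_box q n l x lo hi h, Finset.mul_sum]
    apply Finset.sum_congr rfl
    intro ν _
    split_ifs with hν
    · rw [ih ν, mul_zpow, show z ^ sumz l = z ^ (sumz l - sumz ν) * z ^ sumz ν by
        rw [← zpow_add₀ hz]; congr 1; ring]
      ring
    · simp

open Polynomial in
lemma laurent_coeff {ι : Type} (s : Finset ι) (f : ι → ℝ) (e : ι → ℤ)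
    (h : ∀ z : ℝ, z ≠ 0 → ∑ a ∈ s, f a * z ^ (e a) = 0) (k : ℤ) :
    ∑ a ∈ s, (if e a = k then f a else 0) = 0 := by
  set N : ℤ := (∑ a ∈ s, |e a|) + |k| with hN
  have hbd : ∀ a ∈ s, 0 ≤ e a + N := by
    intro a ha
    have h1 : |e a| ≤ ∑ a ∈ s, |e a| :=
      Finset.single_le_sum (f := fun a => |e a|) (fun j _ => abs_nonneg _) ha
    have h3 := neg_abs_le (e a)
    have h4 := abs_nonneg k
    linarith
  have hk : 0 ≤ k + N := by
    have h1 : 0 ≤ ∑ a ∈ s, |e a| := Finset.sum_nonneg fun _ _ => abs_nonneg _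
    have h3 := neg_abs_le k
    linarith
  set p : ℝ[X] := ∑ a ∈ s, C (f a) * X ^ (e a + N).toNat with hp
  have hp0 : p = 0 := by
    apply Polynomial.eq_zero_of_infinite_isRoot
    apply Set.Infinite.mono (s := {z : ℝ | z ≠ 0})
    · intro z hz
      have hz : z ≠ 0 := hz
      change p.eval z = 0
      rw [hp, eval_finsetSum]
      have : ∀ a ∈ s, (C (f a) * X ^ (e a + N).toNat).eval z = z ^ N * (f a * z ^ e a) := by
        intro a ha
        simp only [eval_mul, eval_C, eval_pow, eval_X]
        rw [← zpow_natCast, Int.toNat_of_nonneg (hbd a ha), zpow_add₀ hz]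
        ring
      rw [Finset.sum_congr rfl this, ← Finset.mul_sum, h z hz, mul_zero]
    · exact (Set.finite_singleton (0 : ℝ)).infinite_compl
  have := congrArg (fun P => Polynomial.coeff P (k + N).toNat) hp0
  simp only [hp, finsetSum_coeff, coeff_C_mul, coeff_X_pow, coeff_zero] at this
  refine Eq.trans ?_ this
  apply Finset.sum_congr rfl
  intro a ha
  have h1 := hbd a ha
  by_cases hh : e a = k
  · rw [if_pos hh, if_pos (by rw [hh]), mul_one]
  · rw [if_neg hh, if_neg (by omega), mul_zero]

lemma HLPfull_LI (q : ℝ) (hq : |q| < 1) (n : ℕ) : ∀ (s : Finset (Fin n → ℤ)) (d : (Fin n → ℤ) → ℝ),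
    (∀ l ∈ s, IsSig l) →
    (∀ x : Fin n → ℝ, (∀ i, x i ≠ 0) → ∑ l ∈ s, d l * HLPfull q l x = 0) →
    ∀ l ∈ s, d l = 0 := by
  induction n with
  | zero =>
    intro s d _ h l hl
    have hs : s = {l} := by
      ext z
      simp [Subsingleton.elim z l, hl]
    have := h (fun i => i.elim0) (fun i => i.elim0)
    rw [hs, Finset.sum_singleton, HLPfull_zero, mul_one] at this
    exact this
  | succ n ih =>
    intro s d hs h
    by_contra hcon
    push Not at hcon
    obtain ⟨l1, hl1, hd1⟩ := hcon
    obtain ⟨l0, hl0, hmin⟩ := Finset.exists_min_image (s.filter fun l => d l ≠ 0)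
      (fun l => l (Fin.last n)) ⟨l1, by simp [hl1, hd1]⟩
    rw [Finset.mem_filter] at hl0
    obtain ⟨lo, hi, hw⟩ := exists_window s
    set k := l0 (Fin.last n) with hk
    set ν0 : Fin n → ℤ := fun i => l0 i.castSucc with hν0
    have hsum0 : sumz l0 = sumz ν0 + k := by
      unfold sumz; rw [Fin.sum_univ_castSucc]
    set B := (box n lo hi).filter IsSig with hB
    have hνB : ν0 ∈ B := by
      rw [hB, Finset.mem_filter, mem_box]
      exact ⟨fun i => hw l0 hl0.1 _, interP_sig_left (interP_castSucc (hs l0 hl0.1))⟩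
    set g : (Fin n → ℤ) → ℝ := fun ν => ∑ l ∈ s, if interP ν l ∧ sumz l - sumz ν = k then
      d l * psiHL q l ν else 0 with hg
    have hIH := ih B g (fun l hl => (Finset.mem_filter.1 hl).2) ?_ ν0 hνB
    · rw [hg] at hIH
      dsimp only at hIH
      rw [Finset.sum_eq_single l0, if_pos ⟨interP_castSucc (hs l0 hl0.1), by omega⟩] at hIH
      · exact (mul_ne_zero hl0.2 (psiHL_pos q hq l0 ν0).ne') hIH
      · intro l hl hne
        split_ifs with hh
        · by_cases hd : d l = 0
          · rw [hd, zero_mul]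
          exfalso
          apply hne
          have hlast : l0 (Fin.last n) ≤ l (Fin.last n) := hmin l (by simp [hl, hd])
          have hle : ∀ i, l0 i ≤ l i := by
            intro i
            refine Fin.lastCases hlast (fun j => ?_) i
            exact (hh.1 j).1
          have hsumeq : ∑ i, l0 i = ∑ i, l i := by
            have h1 := hh.2
            change sumz l0 = sumz l
            omega
          have := (Finset.sum_eq_sum_iff_of_le fun i _ => hle i).1 hsumeq
          funext i
          exact (this i (Finset.mem_univ _)).symm
        · rfl
      · intro hh
        exact absurd hl0.1 hh
    · intro x hx
      have hL := laurent_coeff (s ×ˢ B) (fun a => if interP a.2 a.1 then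
        d a.1 * psiHL q a.1 a.2 * HLPfull q a.2 x else 0) (fun a => sumz a.1 - sumz a.2) ?_ k
      · refine Eq.trans ?_ hL
        rw [Finset.sum_product_right]
        apply Finset.sum_congr rfl
        intro ν _
        rw [hg, Finset.sum_mul]
        apply Finset.sum_congr rfl
        intro l _
        dsimp only
        by_cases h1 : interP ν l <;> by_cases h2 : sumz l - sumz ν = k <;> simp [h1, h2]
      · intro z hz
        have hx' : ∀ i, (Fin.snoc x z : Fin (n + 1) → ℝ) i ≠ 0 := by
          intro i
          refine Fin.lastCases ?_ (fun j => ?_) i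
          · simpa using hz
          · simpa using hx j
        refine Eq.trans ?_ (h (Fin.snoc x z) hx')
        rw [Finset.sum_product]
        apply Finset.sum_congr rfl
        intro l hl
        rw [HLPfull_box q n l _ lo hi (hw l hl), hB, Finset.sum_filter, Finset.mul_sum]
        apply Finset.sum_congr rfl
        intro ν _
        by_cases h1 : interP ν l
        · have h2 := interP_sig_left h1
          simp only [h1, h2, if_true, Fin.snoc_last, Fin.snoc_castSucc]
          ring
        · simp [h1]

lemma HLPfull_zero_sig (q : ℝ) (n : ℕ) (x : Fin n → ℝ) :
    HLPfull q (fun _ => 0) x = 1 := by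
  induction n with
  | zero => exact HLPfull_zero _ _ _
  | succ n ih =>
    rw [HLPfull_box q n _ x 0 1 (fun i => by simp), Finset.sum_eq_single (fun _ => 0)]
    · have hP : interP (fun _ : Fin n => (0 : ℤ)) (fun _ => 0) := fun _ => ⟨le_rfl, le_rfl⟩
      rw [if_pos hP, psi_prod q _ _ 0 1 (fun i => by simp), ih, Finset.prod_eq_one]
      · simp [sumz]
      · intro c hc
        have : c = 0 := by rw [Finset.mem_Ico] at hc; omega
        subst this
        simp [mcount]
        omega
    · intro ν hν hne
      exfalso
      apply hne
      rw [mem_box] at hν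
      funext i
      have := hν i
      omega
    · intro hh
      exfalso
      apply hh
      rw [mem_box]
      intro i
      simp

/-! ### The main identity -/

lemma signList_prod {M : Type} [CommMonoid M] (f : ℝ → M) (s : ℕ) : ∀ cc : Fin s → ℝ,
    ∏ j, f (signList cc j) = ∏ j, (f (cc j) * f (-cc j)) := by
  induction s with
  | zero => intro cc; rfl
  | succ s ih =>
    intro cc
    have h1 := Fin.prod_univ_castSucc (n := 2 * s + 1) (fun j => f (signList cc j))
    have h2 := Fin.prod_univ_castSucc (n := 2 * s)
      (fun j => f (signList cc (Fin.castSucc j : Fin (2 * s + 1 + 1))))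
    rw [Fin.prod_univ_castSucc (n := s), ← ih]
    refine h1.trans ?_
    rw [h2, mul_assoc]
    congr 2
    · congr 1
      unfold signList
      have e1 : 2 * s % 2 = 0 := by omega
      simp only [Fin.val_castSucc, Fin.val_last, e1, pow_zero, one_mul]
      congr 1
      exact Fin.ext (by simp)
    · congr 1
      unfold signList
      have e1 : (2 * s + 1) % 2 = 1 := by omega
      simp only [Fin.val_last, e1, pow_one, neg_mul, one_mul]
      congr 2
      exact Fin.ext (by simp; omega)

lemma PiK_sign {n s : ℕ} (t : ℝ) (a : Fin n → ℝ) (cc : Fin s → ℝ) :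
    PiK (t ^ 2) (fun i => a i ^ 2) (fun j => cc j ^ 2) = PiK (-t) a (signList cc) := by
  unfold PiK
  apply Finset.prod_congr rfl
  intro i _
  rw [signList_prod (fun w => (1 - -t * a i * w) / (1 - a i * w))]
  apply Finset.prod_congr rfl
  intro j _
  rw [div_mul_div_comm]
  congr 1 <;> ring

lemma her_degree {n : ℕ} (t : ℝ) (ht0 : 0 < t) (ht1 : t < 1) (lam μ : Fin n → ℤ)
    (c : (Fin n → ℤ) → Polynomial ℤ) (hc : herExpand n μ lam c) (l : Fin n → ℤ)
    (hl : Polynomial.aeval t (c l) ≠ 0) : sumz l = 2 * sumz μ + sumz lam := by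
  obtain ⟨hfin, hsig, hexp⟩ := hc
  have hq : |(-t)| < 1 := by rw [abs_neg, abs_of_pos ht0]; exact ht1
  have hsum : ∀ x : Fin n → ℝ, (∀ i, x i ≠ 0) →
      HLPfull (t ^ 2) μ (fun i => x i ^ 2) * HLPfull (-t) lam x =
      ∑ l ∈ hfin.toFinset, Polynomial.aeval t (c l) * HLPfull (-t) l x := by
    intro x hx
    rw [hexp ℝ t x hx]
    apply finsum_eq_sum_of_support_subset
    intro l hl
    rw [Function.mem_support] at hl
    rw [Finset.mem_coe, Set.Finite.mem_toFinset]
    intro h0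
    have h0 : c l = 0 := h0
    rw [h0] at hl
    simp at hl
  have hl0 : l ∈ hfin.toFinset := by
    rw [Set.Finite.mem_toFinset]
    intro h0
    have h0 : c l = 0 := h0
    rw [h0] at hl
    simp at hl
  have h2 : (2 : ℝ) ≠ 0 := two_ne_zero
  have := HLPfull_LI (-t) hq n hfin.toFinset
    (fun l => Polynomial.aeval t (c l) * ((2 : ℝ) ^ sumz l - 2 ^ (2 * sumz μ + sumz lam)))
    (fun l hl => hsig l ((Set.Finite.mem_toFinset _).1 hl)) ?_ l hl0
  · rcases mul_eq_zero.1 this with h | h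
    · exact absurd h hl
    · exact zpow_right_injective₀ (by norm_num : (0 : ℝ) < 2) (by norm_num) (sub_eq_zero.1 h)
  · intro x hx
    have e1 := hsum x hx
    have e2 := hsum (fun i => 2 * x i) (fun i => mul_ne_zero h2 (hx i))
    have e3 : (fun i => (2 * x i) ^ 2) = fun i => (2 : ℝ) ^ 2 * x i ^ 2 := by
      funext i; ring
    rw [e3, HLPfull_homog (t ^ 2) ((2 : ℝ) ^ 2) (by norm_num),
      HLPfull_homog (-t) (2 : ℝ) (by norm_num)] at e2
    have e4 : ((2 : ℝ) ^ 2) ^ sumz μ * 2 ^ sumz lam = 2 ^ (2 * sumz μ + sumz lam) := by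
      rw [zpow_add₀ h2, zpow_mul]
      norm_num
    have e5 : (2 : ℝ) ^ (2 * sumz μ + sumz lam) *
        (∑ l ∈ hfin.toFinset, Polynomial.aeval t (c l) * HLPfull (-t) l x) =
        ∑ l ∈ hfin.toFinset, Polynomial.aeval t (c l) * (2 ^ sumz l * HLPfull (-t) l x) := by
      rw [← e1, ← e4]
      simp only [HLPfull_homog (-t) (2 : ℝ) h2] at e2
      rw [← e2]
      ring
    rw [Finset.mul_sum] at e5
    rw [← sub_eq_zero, ← Finset.sum_sub_distrib] at e5
    rw [← neg_eq_zero, ← Finset.sum_neg_distrib]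
    refine Eq.trans (Finset.sum_congr rfl ?_) e5
    intro l _
    ring

open Polynomial in
lemma coeff_compare {n s : ℕ} (t : ℝ) (cc : Fin s → ℝ) (lam : Fin n → ℤ) (hlam : IsSig lam)
    (hlam0 : ∀ i, 0 ≤ lam i) (d : ℕ) (hi : ℤ) (hhi : ∀ i, lam i + (d + 1 : ℕ) < hi)
    (hhi' : (d + 1 : ℕ) < hi) (x : Fin n → ℝ) (hx : ∀ i, x i ≠ 0) :
    (∑ z ∈ box n 0 hi, if (sumz z - sumz lam).toNat = d then
      HLQ (-t) (2 * s) lam z (signList cc) * HLPfull (-t) z x else 0) =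
    ∑ μ ∈ box n 0 hi, if 2 * (sumz μ).toNat = d then
      HLQ (t ^ 2) s (fun _ => 0) μ (fun j => cc j ^ 2) *
        (HLPfull (t ^ 2) μ (fun i => x i ^ 2) * HLPfull (-t) lam x) else 0 := by
  have h1 := cauchyMany_rel (-t) (X : ℝ[X]) 0 hi x hx lam hlam (d + 1)
    (fun i => ⟨hlam0 i, hhi i⟩) (2 * s) (signList cc)
  have h2 := cauchyMany_rel (t ^ 2) (X ^ 2 : ℝ[X]) 0 hi (fun i => x i ^ 2)
    (fun i => pow_ne_zero 2 (hx i)) (fun _ => 0) (fun _ _ _ => le_rfl) (d + 1)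
    (fun i => ⟨le_rfl, by simpa using hhi'⟩) s (fun j => cc j ^ 2)
  rw [HLPfull_zero_sig] at h2
  have eA : (∏ j, ∏ i, (1 - C (x i * signList cc j) * X) : ℝ[X]) =
      ∏ j, ∏ i, (1 - C (x i ^ 2 * cc j ^ 2) * X ^ 2) := by
    rw [signList_prod (fun w => (∏ i, (1 - C (x i * w) * X) : ℝ[X]))]
    apply Finset.prod_congr rfl
    intro j _
    rw [← Finset.prod_mul_distrib]
    apply Finset.prod_congr rfl
    intro i _
    simp only [map_mul, map_neg, map_pow]
    ring
  have eB : (∏ j, ∏ i, (1 - C (-t * (x i * signList cc j)) * X) : ℝ[X]) =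
      ∏ j, ∏ i, (1 - C (t ^ 2 * (x i ^ 2 * cc j ^ 2)) * X ^ 2) := by
    rw [signList_prod (fun w => (∏ i, (1 - C (-t * (x i * w)) * X) : ℝ[X]))]
    apply Finset.prod_congr rfl
    intro j _
    rw [← Finset.prod_mul_distrib]
    apply Finset.prod_congr rfl
    intro i _
    simp only [map_mul, map_neg, map_pow]
    ring
  rw [← eA, ← eB] at h2
  set A : ℝ[X] := ∏ j, ∏ i, (1 - C (x i * signList cc j) * X) with hA
  set B : ℝ[X] := ∏ j, ∏ i, (1 - C (-t * (x i * signList cc j)) * X) with hB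
  set S1 : ℝ[X] := ∑ z ∈ box n 0 hi, C (HLQ (-t) (2 * s) lam z (signList cc) * HLPfull (-t) z x) *
    X ^ (sumz z - sumz lam).toNat with hS1
  set S2 : ℝ[X] := ∑ z ∈ box n 0 hi, C (HLQ (t ^ 2) s (fun _ => 0) z (fun j => cc j ^ 2) *
    HLPfull (t ^ 2) z (fun i => x i ^ 2)) *
    (X ^ 2) ^ (sumz z - sumz (fun _ : Fin n => (0 : ℤ))).toNat with hS2
  have hco : IsCoprime ((X : ℝ[X]) ^ (d + 1)) A := by
    apply IsCoprime.pow_left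
    apply IsCoprime.prod_right
    intro j _
    apply IsCoprime.prod_right
    intro i _
    exact ⟨C (x i * signList cc j), 1, by ring⟩
  have h2' : (X : ℝ[X]) ^ (d + 1) ∣ A * S2 - B * C 1 :=
    (pow_dvd_pow_of_dvd (dvd_pow_self X two_ne_zero) _).trans h2
  have h3 : (X : ℝ[X]) ^ (d + 1) ∣ A * (S1 - S2 * C (HLPfull (-t) lam x)) := by
    refine dvd_of_dvd_of_eq (dvd_sub h1 (h2'.mul_left (C (HLPfull (-t) lam x)))) ?_
    rw [map_one]
    ring
  have h4 := hco.dvd_of_dvd_mul_left h3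
  have h5 := (X_pow_dvd_iff.1 h4) d (Nat.lt_succ_self d)
  rw [coeff_sub, sub_eq_zero, hS1, hS2, coeff_mul_C, finsetSum_coeff, finsetSum_coeff,
    Finset.sum_mul] at h5
  have hz0 : sumz (fun _ : Fin n => (0 : ℤ)) = 0 := by simp [sumz]
  simp only [coeff_C_mul, ← pow_mul, coeff_X_pow, hz0, sub_zero] at h5
  refine Eq.trans ?_ (h5.trans ?_)
  · apply Finset.sum_congr rfl
    intro z _
    by_cases h : (sumz z - sumz lam).toNat = d
    · rw [if_pos h, if_pos h.symm, mul_one]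
    · rw [if_neg h, if_neg (fun h' => h h'.symm), mul_zero]
  · apply Finset.sum_congr rfl
    intro z _
    by_cases h : 2 * (sumz z).toNat = d
    · rw [if_pos h, if_pos h.symm, mul_one, mul_assoc]
    · rw [if_neg h, if_neg (fun h' => h h'.symm), mul_zero, zero_mul]

lemma her_key {n s : ℕ} (t : ℝ) (ht0 : 0 < t) (ht1 : t < 1) (cc : Fin s → ℝ)
    (lam lam' : Fin n → ℤ) (hlam : IsSig lam) (hlam0 : ∀ i, 0 ≤ lam i)
    (hlam' : IsSig lam') (hlam'0 : ∀ i, 0 ≤ lam' i)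
    (c : (Fin n → ℤ) → (Fin n → ℤ) → Polynomial ℤ)
    (hc : ∀ μ : Fin n → ℤ, IsSig μ → (∀ i, 0 ≤ μ i) → herExpand n μ lam (c μ)) :
    (∑ᶠ μ : Fin n → ℤ, if IsSig μ ∧ ∀ i, 0 ≤ μ i then
      HLQ (t ^ 2) s (fun _ => 0) μ (fun j => cc j ^ 2) * Polynomial.aeval t (c μ lam') else 0) =
    HLQ (-t) (2 * s) lam lam' (signList cc) := by
  have hq : |(-t)| < 1 := by rw [abs_neg, abs_of_pos ht0]; exact ht1
  have hnn : ∀ μ : Fin n → ℤ, (∀ i, 0 ≤ μ i) → 0 ≤ sumz μ := fun μ h =>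
    Finset.sum_nonneg fun i _ => h i
  by_cases hlt : sumz lam' < sumz lam
  · have hR : HLQ (-t) (2 * s) lam lam' (signList cc) = 0 := by
      by_contra h
      have := sumz_mono (HLQ_ne_zero (-t) lam hlam _ lam' _ h).2
      omega
    rw [hR]
    refine (finsum_congr fun μ => ?_).trans finsum_zero
    split_ifs with h
    · by_cases h0 : Polynomial.aeval t (c μ lam') = 0
      · rw [h0, mul_zero]
      · have h1 := her_degree t ht0 ht1 lam μ (c μ) (hc μ h.1 h.2) lam' h0
        have h2 := hnn μ h.2
        omega
    · rfl
  obtain ⟨d, hd⟩ := Int.eq_ofNat_of_zero_le (sub_nonneg.2 (not_lt.1 hlt))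
  set hi : ℤ := sumz lam + sumz lam' + d + 2 with hhi
  have hle : ∀ μ : Fin n → ℤ, (∀ i, 0 ≤ μ i) → ∀ i, μ i ≤ sumz μ := fun μ h i =>
    Finset.single_le_sum (f := μ) (fun j _ => h j) (Finset.mem_univ i)
  have hl0 := hnn lam hlam0
  have hl0' := hnn lam' hlam'0
  set B := (box n 0 hi).filter IsSig with hB
  have hBm : ∀ μ, μ ∈ B ↔ (∀ i, 0 ≤ μ i ∧ μ i < hi) ∧ IsSig μ := by
    intro μ
    rw [hB, Finset.mem_filter, mem_box]
  have hfin : ∀ μ, ∃ S : Finset (Fin n → ℤ), μ ∈ B → (∀ l, c μ l ≠ 0 → l ∈ S) ∧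
      ∀ l ∈ S, IsSig l := by
    intro μ
    by_cases hμ : μ ∈ B
    · obtain ⟨h1, h2⟩ := (hBm μ).1 hμ
      obtain ⟨hf, hs, -⟩ := hc μ h2 (fun i => (h1 i).1)
      exact ⟨hf.toFinset, fun _ => ⟨fun l hl => (Set.Finite.mem_toFinset _).2 hl,
        fun l hl => hs l ((Set.Finite.mem_toFinset _).1 hl)⟩⟩
    · exact ⟨∅, fun h => absurd h hμ⟩
  choose S hS using hfin
  set U := B ∪ B.biUnion S with hU
  have hUs : ∀ l ∈ U, IsSig l := by
    intro l hl
    rw [hU, Finset.mem_union, Finset.mem_biUnion] at hl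
    rcases hl with hl | ⟨μ, hμ, hl⟩
    · exact ((hBm l).1 hl).2
    · exact (hS μ hμ).2 l hl
  have hlamB : lam' ∈ B := by
    rw [hBm]
    refine ⟨fun i => ⟨hlam'0 i, ?_⟩, hlam'⟩
    have := hle lam' hlam'0 i
    omega
  set g : (Fin n → ℤ) → ℝ := fun l =>
    (if l ∈ B ∧ (sumz l - sumz lam).toNat = d then HLQ (-t) (2 * s) lam l (signList cc) else 0) -
    ∑ μ ∈ B, (if 2 * (sumz μ).toNat = d then
      HLQ (t ^ 2) s (fun _ => 0) μ (fun j => cc j ^ 2) * Polynomial.aeval t (c μ l) else 0) with hg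
  have hg0 : g lam' = 0 := by
    apply HLPfull_LI (-t) hq n U g hUs _ lam' (Finset.mem_union_left _ hlamB)
    intro x hx
    have hcmp := coeff_compare t cc lam hlam hlam0 d hi (fun i => by
      have := hle lam hlam0 i
      push_cast
      omega) (by push_cast; omega) x hx
    have e1 : ∑ l ∈ U, (if l ∈ B ∧ (sumz l - sumz lam).toNat = d then
        HLQ (-t) (2 * s) lam l (signList cc) else 0) * HLPfull (-t) l x =
        (∑ z ∈ box n 0 hi, if (sumz z - sumz lam).toNat = d then
          HLQ (-t) (2 * s) lam z (signList cc) * HLPfull (-t) z x else 0) := by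
      have e1a : ∑ l ∈ U, (if l ∈ B ∧ (sumz l - sumz lam).toNat = d then
          HLQ (-t) (2 * s) lam l (signList cc) else 0) * HLPfull (-t) l x =
          ∑ l ∈ B, (if l ∈ B ∧ (sumz l - sumz lam).toNat = d then
          HLQ (-t) (2 * s) lam l (signList cc) else 0) * HLPfull (-t) l x := by
        symm
        apply Finset.sum_subset Finset.subset_union_left
        intro l _ hl
        rw [if_neg (fun h => hl h.1), zero_mul]
      rw [e1a]
      conv_lhs => rw [hB, Finset.sum_filter]
      apply Finset.sum_congr rfl
      intro z hz
      by_cases hzs : IsSig z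
      · have hzB : z ∈ B := Finset.mem_filter.2 ⟨hz, hzs⟩
        rw [if_pos hzs]
        by_cases h : (sumz z - sumz lam).toNat = d
        · rw [if_pos ⟨hzB, h⟩, if_pos h]
        · rw [if_neg (fun h' => h h'.2), if_neg h, zero_mul]
      · rw [if_neg hzs]
        have : HLQ (-t) (2 * s) lam z (signList cc) = 0 := by
          by_contra h
          exact hzs (HLQ_ne_zero (-t) lam hlam _ z _ h).1
        rw [this, zero_mul, ite_self]
    have e2 : (∑ μ ∈ box n 0 hi, if 2 * (sumz μ).toNat = d then
        HLQ (t ^ 2) s (fun _ => 0) μ (fun j => cc j ^ 2) *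
        (HLPfull (t ^ 2) μ (fun i => x i ^ 2) * HLPfull (-t) lam x) else 0) =
        ∑ μ ∈ B, ∑ l ∈ U, (if 2 * (sumz μ).toNat = d then
          HLQ (t ^ 2) s (fun _ => 0) μ (fun j => cc j ^ 2) * Polynomial.aeval t (c μ l)
          else 0) * HLPfull (-t) l x := by
      conv_rhs => rw [hB, Finset.sum_filter]
      apply Finset.sum_congr rfl
      intro μ hμ
      by_cases hμs : IsSig μ
      · have hμB : μ ∈ B := Finset.mem_filter.2 ⟨hμ, hμs⟩
        rw [if_pos hμs]
        by_cases h : 2 * (sumz μ).toNat = d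
        · simp only [if_pos h]
          rw [(hc μ hμs (fun i => (((hBm μ).1 hμB).1 i).1)).2.2 ℝ t x hx,
            finsum_eq_sum_of_support_subset (s := U), Finset.mul_sum]
          · apply Finset.sum_congr rfl
            intro l _
            ring
          · intro l hl
            rw [Function.mem_support] at hl
            rw [Finset.mem_coe, hU, Finset.mem_union, Finset.mem_biUnion]
            refine Or.inr ⟨μ, hμB, (hS μ hμB).1 l ?_⟩
            intro h0
            rw [h0] at hl
            simp at hl
        · simp [h]
      · rw [if_neg hμs]
        have : HLQ (t ^ 2) s (fun _ => 0) μ (fun j => cc j ^ 2) = 0 := by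
          by_contra h
          exact hμs (HLQ_ne_zero (t ^ 2) _ (fun _ _ _ => le_rfl) _ μ _ h).1
        rw [this, zero_mul, ite_self]
    rw [Finset.sum_comm] at e2
    simp only [hg, sub_mul, Finset.sum_sub_distrib, Finset.sum_mul]
    rw [e1, hcmp, e2, sub_self]
  rw [hg] at hg0
  dsimp only at hg0
  rw [if_pos ⟨hlamB, by omega⟩, sub_eq_zero] at hg0
  rw [hg0, finsum_eq_sum_of_support_subset (s := B)]
  · apply Finset.sum_congr rfl
    intro μ hμ
    obtain ⟨h1, h2⟩ := (hBm μ).1 hμ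
    rw [if_pos ⟨h2, fun i => (h1 i).1⟩]
    by_cases h0 : Polynomial.aeval t (c μ lam') = 0
    · rw [h0, mul_zero, ite_self]
    · have h3 := her_degree t ht0 ht1 lam μ (c μ) (hc μ h2 fun i => (h1 i).1) lam' h0
      rw [if_pos]
      omega
  · intro μ hμ
    rw [Function.mem_support] at hμ
    have hs : IsSig μ ∧ ∀ i, 0 ≤ μ i := by
      by_contra h
      exact hμ (if_neg h)
    rw [if_pos hs] at hμ
    have h3 := her_degree t ht0 ht1 lam μ (c μ) (hc μ hs.1 hs.2) lam' (right_ne_zero_of_mul hμ)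
    have h4 := hnn μ hs.2
    rw [Finset.mem_coe, hBm]
    refine ⟨fun i => ⟨hs.2 i, ?_⟩, hs.1⟩
    have := hle μ hs.2 i
    omega

/-- the Hermitian product convolution yields a Hall–Littlewood process
(case `k = 1`): the joint probability that a Hall–Littlewood-distributed `ν` equals `λ` and
`μ ⊠ʰᵉʳ ν` equals `λ'` is given by the Hall–Littlewood process formula, and all denominators
appearing are nonzero. -/
theorem stmt19 (n r s : ℕ) (hn : 1 ≤ n) (t : ℝ) (ht0 : 0 < t) (ht1 : t < 1)
    (a : Fin n → ℝ) (ha : ∀ i, 0 < a i)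
    (b : Fin r → ℝ) (hb : ∀ j, 0 ≤ b j)
    (cc : Fin s → ℝ) (hcc : ∀ j, 0 ≤ cc j)
    (hab : ∀ i j, a i * b j ^ 2 < 1) (hac : ∀ i j, a i * cc j < 1)
    (lam lam' : Fin n → ℤ) (hlam : IsSig lam) (hlam0 : ∀ i, 0 ≤ lam i)
    (hlam' : IsSig lam') (hlam'0 : ∀ i, 0 ≤ lam' i)
    (c : (Fin n → ℤ) → (Fin n → ℤ) → Polynomial ℤ)
    (hc : ∀ μ : Fin n → ℤ, IsSig μ → (∀ i, 0 ≤ μ i) → herExpand n μ lam (c μ)) :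
    PiK (-t) a (fun j => b j ^ 2) ≠ 0 ∧
    PiK (t ^ 2) (fun i => a i ^ 2) (fun j => cc j ^ 2) ≠ 0 ∧
    PiK (-t) a (signList cc) ≠ 0 ∧
    HLPfull (-t) lam a ≠ 0 ∧
    (∀ μ : Fin n → ℤ, IsSig μ → (∀ i, 0 ≤ μ i) → HLPfull (t ^ 2) μ (fun i => a i ^ 2) ≠ 0) ∧
    (HLPfull (-t) lam a * HLQ (-t) r (fun _ => 0) lam (fun j => b j ^ 2) /
          PiK (-t) a (fun j => b j ^ 2)) *
        (∑ᶠ μ : Fin n → ℤ,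
          if IsSig μ ∧ ∀ i, 0 ≤ μ i then
            (HLPfull (t ^ 2) μ (fun i => a i ^ 2) *
                HLQ (t ^ 2) s (fun _ => 0) μ (fun j => cc j ^ 2) /
                PiK (t ^ 2) (fun i => a i ^ 2) (fun j => cc j ^ 2)) *
              (Polynomial.aeval t (c μ lam') * HLPfull (-t) lam' a /
                (HLPfull (t ^ 2) μ (fun i => a i ^ 2) * HLPfull (-t) lam a))
          else 0)
      = HLQ (-t) r (fun _ => 0) lam (fun j => b j ^ 2) *
          HLQ (-t) (2 * s) lam lam' (signList cc) * HLPfull (-t) lam' a /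
          (PiK (-t) a (fun j => b j ^ 2) * PiK (-t) a (signList cc)) := by
  have hq : |(-t)| < 1 := by rw [abs_neg, abs_of_pos ht0]; exact ht1
  have hq2 : |t ^ 2| < 1 := by
    rw [abs_pow, abs_of_pos ht0]
    exact pow_lt_one₀ ht0.le ht1 two_ne_zero
  have hP1 : PiK (-t) a (fun j => b j ^ 2) ≠ 0 := by
    unfold PiK
    apply Finset.prod_ne_zero_iff.2
    intro i _
    apply Finset.prod_ne_zero_iff.2
    intro j _
    have h0 : 0 ≤ t * (a i * b j ^ 2) := mul_nonneg ht0.le (mul_nonneg (ha i).le (sq_nonneg _))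
    apply div_ne_zero
    · apply ne_of_gt
      linarith
    · exact (sub_pos.2 (hab i j)).ne'
  have hP2 : PiK (t ^ 2) (fun i => a i ^ 2) (fun j => cc j ^ 2) ≠ 0 := by
    unfold PiK
    apply Finset.prod_ne_zero_iff.2
    intro i _
    apply Finset.prod_ne_zero_iff.2
    intro j _
    have h0 : 0 ≤ a i * cc j := mul_nonneg (ha i).le (hcc j)
    have h1 : (a i * cc j) ^ 2 < 1 := pow_lt_one₀ h0 (hac i j) two_ne_zero
    have h2 : t ^ 2 < 1 := pow_lt_one₀ ht0.le ht1 two_ne_zero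
    have h3 : t ^ 2 * (a i * cc j) ^ 2 < 1 := by
      nlinarith [sq_nonneg (a i * cc j), sq_nonneg t]
    apply div_ne_zero
    · apply ne_of_gt
      nlinarith
    · apply ne_of_gt
      nlinarith
  have hP3 : PiK (-t) a (signList cc) ≠ 0 := by
    rw [← PiK_sign]
    exact hP2
  have hlamP := (HLPfull_pos (-t) hq n lam hlam a ha).ne'
  have hμP : ∀ μ : Fin n → ℤ, IsSig μ → (∀ i, 0 ≤ μ i) →
      HLPfull (t ^ 2) μ (fun i => a i ^ 2) ≠ 0 := fun μ hμ _ =>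
    (HLPfull_pos (t ^ 2) hq2 n μ hμ _ fun i => pow_pos (ha i) 2).ne'
  refine ⟨hP1, hP2, hP3, hlamP, hμP, ?_⟩
  have hkey := her_key t ht0 ht1 cc lam lam' hlam hlam0 hlam' hlam'0 c hc
  have hfs : (∑ᶠ μ : Fin n → ℤ,
          if IsSig μ ∧ ∀ i, 0 ≤ μ i then
            (HLPfull (t ^ 2) μ (fun i => a i ^ 2) *
                HLQ (t ^ 2) s (fun _ => 0) μ (fun j => cc j ^ 2) /
                PiK (t ^ 2) (fun i => a i ^ 2) (fun j => cc j ^ 2)) *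
              (Polynomial.aeval t (c μ lam') * HLPfull (-t) lam' a /
                (HLPfull (t ^ 2) μ (fun i => a i ^ 2) * HLPfull (-t) lam a))
          else 0) = (HLPfull (-t) lam' a / (PiK (-t) a (signList cc) * HLPfull (-t) lam a)) *
      HLQ (-t) (2 * s) lam lam' (signList cc) := by
    rw [← hkey, ← smul_eq_mul, smul_finsum]
    apply finsum_congr
    intro μ
    by_cases h : IsSig μ ∧ ∀ i, 0 ≤ μ i
    · rw [if_pos h, if_pos h, PiK_sign, smul_eq_mul]
      have := hμP μ h.1 h.2
      field_simp
    · rw [if_neg h, if_neg h, smul_zero]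
  rw [hfs]
  field_simp

end
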